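/- arXiv:1405.4980 — 11 statements merged into one kernel-verified Lean document; each statement's English description precedes it below -/
import Mathlib

section
/- Let K ⊂ ℝⁿ be a compact convex set of positive Lebesgue measure whose center of gravity is the origin, i.e. ∫_K x dx = 0 (Bochner integral with respect to Lebesgue measure restricted to K). Then for every w ∈ ℝⁿ with w ≠ 0 one has vol(K ∩ {x ∈ ℝⁿ : ⟪w, x⟫ ≥ 0}) ≥ (1/e) · vol(K). -/
open MeasureTheory
open scoped RealInnerProductSpace ENNReal
open Set
open scoped Pointwise

theorem ENNReal.rpow_mul_rpow_le_add {a b : ℝ} (ha : 0 < a) (hb : 0 < b) (hab : a + b = 1)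
    (x y : ℝ≥0∞) : x ^ a * y ^ b ≤ ENNReal.ofReal a * x + ENNReal.ofReal b * y := by
  have hp : (1 / a).HolderConjugate (1 / b) := by
    rw [Real.holderConjugate_iff]
    constructor
    · rw [lt_div_iff₀ ha]; linarith
    · simpa using hab
  have h := ENNReal.young_inequality (x ^ a) (y ^ b) hp
  rw [← ENNReal.rpow_mul, ← ENNReal.rpow_mul, mul_one_div_cancel ha.ne', mul_one_div_cancel hb.ne',
    ENNReal.rpow_one, ENNReal.rpow_one, one_div, one_div, ENNReal.ofReal_inv_of_pos ha,
    ENNReal.ofReal_inv_of_pos hb, div_eq_mul_inv, div_eq_mul_inv, inv_inv, inv_inv] at h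
  rwa [mul_comm _ x, mul_comm _ y]

theorem Real.volume_image_mul_add {a : ℝ} (ha : 0 < a) (c : ℝ) (s : Set ℝ) :
    volume ((fun x => a * x + c) '' s) = ENNReal.ofReal a * volume s := by
  have : (fun x => a * x + c) '' s = (fun x => x + c) '' (a • s) := by
    rw [← image_smul, image_image]; rfl
  rw [this, image_add_right, measure_preimage_add_right, Measure.addHaar_smul]
  simp [abs_of_pos ha]

theorem Real.volume_add_volume_le_of_isCompact {a b : ℝ} (ha : 0 < a) (hb : 0 < b) {A B C : Set ℝ}
    (hA : IsCompact A) (hB : IsCompact B) (hA' : A.Nonempty) (hB' : B.Nonempty)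
    (h : ∀ x ∈ A, ∀ y ∈ B, a * x + b * y ∈ C) :
    ENNReal.ofReal a * volume A + ENNReal.ofReal b * volume B ≤ volume C := by
  obtain ⟨p, hpA, hp⟩ := hA.exists_isGreatest hA'
  obtain ⟨q, hqB, hq⟩ := hB.exists_isLeast hB'
  rw [← Real.volume_image_mul_add ha (b * q), ← Real.volume_image_mul_add hb (a * p)]
  rw [← measure_union₀]
  · apply measure_mono
    rintro _ (⟨x, hx, rfl⟩ | ⟨y, hy, rfl⟩)
    · exact h x hx q hqB
    · simpa [add_comm] using h p hpA y hy
  · exact (hB.image (by fun_prop)).measurableSet.nullMeasurableSet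
  · refine measure_mono_null (t := {a * p + b * q}) ?_ (by simp)
    rintro _ ⟨⟨x, hx, rfl⟩, ⟨y, hy, hxy⟩⟩
    have h1 := mul_le_mul_of_nonneg_left (hp hx) ha.le
    have h2 := mul_le_mul_of_nonneg_left (hq hy) hb.le
    simp only at hxy
    simp only [mem_singleton_iff]
    linarith

theorem Real.volume_add_volume_le {a b : ℝ} (ha : 0 < a) (hb : 0 < b) {A B C : Set ℝ}
    (hA : MeasurableSet A) (hB : MeasurableSet B) (hA' : A.Nonempty) (hB' : B.Nonempty)
    (h : ∀ x ∈ A, ∀ y ∈ B, a * x + b * y ∈ C) :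
    ENNReal.ofReal a * volume A + ENNReal.ofReal b * volume B ≤ volume C := by
  obtain ⟨p, hp⟩ := hA'
  obtain ⟨q, hq⟩ := hB'
  have key {D : Set ℝ} (hD : MeasurableSet D) :
      volume D = ⨆ K : {K : Set ℝ // K ⊆ D ∧ IsCompact K}, volume K.1 := by
    rw [hD.measure_eq_iSup_isCompact]
    simp only [iSup_subtype, iSup_and]
  have ne (D : Set ℝ) : Nonempty {K : Set ℝ // K ⊆ D ∧ IsCompact K} :=
    ⟨∅, empty_subset _, isCompact_empty⟩
  have := ne A
  have := ne B
  rw [key hA, key hB, ENNReal.mul_iSup, ENNReal.mul_iSup, ENNReal.iSup_add]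
  refine iSup_le fun K => ?_
  rw [ENNReal.add_iSup]
  refine iSup_le fun L => ?_
  refine le_trans ?_ (Real.volume_add_volume_le_of_isCompact ha hb (K.2.2.insert p)
    (L.2.2.insert q) (insert_nonempty _ _) (insert_nonempty _ _)
    fun x hx y hy => h x (insert_subset hp K.2.1 hx) y (insert_subset hq L.2.1 hy))
  gcongr <;> exact subset_insert _ _

theorem lintegral_eq_lintegral_meas_lt_of_le_one {f : ℝ → ℝ≥0∞} (hf : Measurable f)
    (h1 : ∀ x, f x ≤ 1) :
    ∫⁻ x, f x = ∫⁻ t in Ioi (0 : ℝ), volume {x | ENNReal.ofReal t < f x} := by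
  have hfin x : f x ≠ ∞ := ne_top_of_le_ne_top ENNReal.one_ne_top (h1 x)
  have := lintegral_eq_lintegral_meas_lt volume (f := fun x => (f x).toReal)
    (.of_forall fun _ => ENNReal.toReal_nonneg) hf.ennreal_toReal.aemeasurable
  simp only [ENNReal.ofReal_toReal (hfin _)] at this
  rw [this]
  refine setLIntegral_congr_fun measurableSet_Ioi fun t ht => ?_
  simp only [ENNReal.ofReal_lt_iff_lt_toReal (le_of_lt ht) (hfin _)]

/-- The Prékopa–Leindler inequality on `ℝ` for functions with supremum `1`. -/
theorem prekopa_leindler_real_of_iSup_eq_one {a b : ℝ} (ha : 0 < a) (hb : 0 < b) (hab : a + b = 1)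
    {f g h : ℝ → ℝ≥0∞} (hf : Measurable f) (hg : Measurable g) (hh : Measurable h)
    (hf1 : ⨆ x, f x = 1) (hg1 : ⨆ x, g x = 1)
    (H : ∀ x y, f x ^ a * g y ^ b ≤ h (a * x + b * y)) :
    (∫⁻ x, f x) ^ a * (∫⁻ x, g x) ^ b ≤ ∫⁻ x, h x := by
  have hfle x : f x ≤ 1 := hf1 ▸ le_iSup f x
  have hgle x : g x ≤ 1 := hg1 ▸ le_iSup g x
  calc (∫⁻ x, f x) ^ a * (∫⁻ x, g x) ^ b
      ≤ ENNReal.ofReal a * (∫⁻ x, f x) + ENNReal.ofReal b * ∫⁻ x, g x :=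
        ENNReal.rpow_mul_rpow_le_add ha hb hab _ _
    _ ≤ ∫⁻ x, min (h x) 1 := ?_
    _ ≤ ∫⁻ x, h x := lintegral_mono fun x => min_le_left _ _
  rw [lintegral_eq_lintegral_meas_lt_of_le_one hf hfle,
    lintegral_eq_lintegral_meas_lt_of_le_one hg hgle,
    lintegral_eq_lintegral_meas_lt_of_le_one (hh.min measurable_const) fun _ => min_le_right _ _,
    ← lintegral_const_mul' _ _ ENNReal.ofReal_ne_top,
    ← lintegral_const_mul' _ _ ENNReal.ofReal_ne_top,
    ← lintegral_add_left']
  · refine setLIntegral_mono' measurableSet_Ioi fun t ht => ?_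
    rcases lt_or_ge t 1 with h1 | h1
    · have ht1 : ENNReal.ofReal t < 1 := by simpa using h1
      refine Real.volume_add_volume_le ha hb (measurableSet_lt measurable_const hf)
        (measurableSet_lt measurable_const hg)
        (nonempty_def.2 (lt_iSup_iff.1 (ht1.trans_eq hf1.symm)))
        (nonempty_def.2 (lt_iSup_iff.1 (ht1.trans_eq hg1.symm))) fun x hx y hy => ?_
      simp only [mem_ofPred_eq] at hx hy ⊢
      refine lt_min (lt_of_lt_of_le ?_ (H x y)) ht1
      calc ENNReal.ofReal t = ENNReal.ofReal t ^ a * ENNReal.ofReal t ^ b := by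
            rw [← ENNReal.rpow_add_of_nonneg _ _ ha.le hb.le, hab, ENNReal.rpow_one]
        _ < _ := ENNReal.mul_lt_mul (ENNReal.rpow_lt_rpow hx ha) (ENNReal.rpow_lt_rpow hy hb)
    · have ht1 : 1 ≤ ENNReal.ofReal t := by simpa using h1
      have e1 : {x | ENNReal.ofReal t < f x} = ∅ := by
        ext x; simpa using (hfle x).trans ht1
      have e2 : {x | ENNReal.ofReal t < g x} = ∅ := by
        ext x; simpa using (hgle x).trans ht1
      simp [e1, e2]
  · refine (Antitone.measurable ?_).aemeasurable
    intro s t hst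
    dsimp only
    gcongr

/-- The Prékopa–Leindler inequality on `ℝ`. -/
theorem prekopa_leindler_real {a b : ℝ} (ha : 0 < a) (hb : 0 < b) (hab : a + b = 1)
    {f g h : ℝ → ℝ≥0∞} (hf : Measurable f) (hg : Measurable g) (hh : Measurable h)
    (H : ∀ x y, f x ^ a * g y ^ b ≤ h (a * x + b * y)) :
    (∫⁻ x, f x) ^ a * (∫⁻ x, g x) ^ b ≤ ∫⁻ x, h x := by
  have bdd {f g : ℝ → ℝ≥0∞} (hf : Measurable f) (hg : Measurable g)
      (hft : ⨆ x, f x ≠ ∞) (hgt : ⨆ x, g x ≠ ∞)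
      (H : ∀ x y, f x ^ a * g y ^ b ≤ h (a * x + b * y)) :
      (∫⁻ x, f x) ^ a * (∫⁻ x, g x) ^ b ≤ ∫⁻ x, h x := by
    set S := ⨆ x, f x with hS
    set T := ⨆ x, g x with hT
    rcases eq_or_ne S 0 with hS0 | hS0
    · have : f = 0 := by ext x; exact ENNReal.iSup_eq_zero.1 hS0 x
      simp [this, ha]
    rcases eq_or_ne T 0 with hT0 | hT0
    · have : g = 0 := by ext x; exact ENNReal.iSup_eq_zero.1 hT0 x
      simp [this, hb]
    have hSa : S ^ a ≠ 0 := by simp [hS0, hft]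
    have hTb : T ^ b ≠ 0 := by simp [hT0, hgt]
    have hSa' : S ^ a ≠ ∞ := ENNReal.rpow_ne_top_of_nonneg ha.le hft
    have hTb' : T ^ b ≠ ∞ := ENNReal.rpow_ne_top_of_nonneg hb.le hgt
    have key := prekopa_leindler_real_of_iSup_eq_one ha hb hab (f := fun x => S⁻¹ * f x)
      (g := fun x => T⁻¹ * g x) (h := fun x => (S ^ a * T ^ b)⁻¹ * h x) (hf.const_mul _)
      (hg.const_mul _) (hh.const_mul _)
      (by rw [← ENNReal.mul_iSup, ENNReal.inv_mul_cancel hS0 hft])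
      (by rw [← ENNReal.mul_iSup, ENNReal.inv_mul_cancel hT0 hgt])
      (fun x y => by
        rw [ENNReal.mul_rpow_of_nonneg _ _ ha.le, ENNReal.mul_rpow_of_nonneg _ _ hb.le,
          ENNReal.inv_rpow, ENNReal.inv_rpow, mul_mul_mul_comm,
          ENNReal.mul_inv (.inl hSa) (.inl hSa')]
        gcongr
        exact H x y)
    rw [lintegral_const_mul _ hf, lintegral_const_mul _ hg, lintegral_const_mul _ hh,
      ENNReal.mul_rpow_of_nonneg _ _ ha.le, ENNReal.mul_rpow_of_nonneg _ _ hb.le,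
      ENNReal.inv_rpow, ENNReal.inv_rpow, mul_mul_mul_comm,
      ← ENNReal.mul_inv (.inl hSa) (.inl hSa')] at key
    exact (ENNReal.mul_le_mul_iff_right (by simp [hSa', hTb', ENNReal.mul_eq_top])
      (by simp [hSa, hTb])).1 key
  have trunc {f : ℝ → ℝ≥0∞} (hf : Measurable f) {c : ℝ} (hc : 0 < c) :
      (∫⁻ x, f x) ^ c = ⨆ N : ℕ, (∫⁻ x, min (f x) N) ^ c := by
    have : ∀ x, f x = ⨆ N : ℕ, min (f x) N := fun x => by
      rw [← inf_iSup_eq, ENNReal.iSup_natCast, inf_top_eq]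
    conv_lhs => rw [lintegral_congr this]
    rw [lintegral_iSup (fun N => hf.min measurable_const)]
    · exact (ENNReal.orderIsoRpow c hc).map_iSup _
    · intro m n hmn x
      dsimp only
      gcongr
  rw [trunc hf ha, trunc hg hb, ENNReal.iSup_mul]
  refine iSup_le fun M => ?_
  rw [ENNReal.mul_iSup]
  refine iSup_le fun N => bdd (hf.min measurable_const) (hg.min measurable_const)
    (ne_top_of_le_ne_top (ENNReal.natCast_ne_top M) (iSup_le fun _ => min_le_right _ _))
    (ne_top_of_le_ne_top (ENNReal.natCast_ne_top N) (iSup_le fun _ => min_le_right _ _))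
    fun x y => le_trans ?_ (H x y)
  gcongr <;> exact min_le_left _ _

/-- The Prékopa–Leindler inequality on `ℝⁿ`. -/
theorem prekopa_leindler {a b : ℝ} (ha : 0 < a) (hb : 0 < b) (hab : a + b = 1) (n : ℕ)
    {f g h : (Fin n → ℝ) → ℝ≥0∞} (hf : Measurable f) (hg : Measurable g) (hh : Measurable h)
    (H : ∀ x y, f x ^ a * g y ^ b ≤ h (a • x + b • y)) :
    (∫⁻ x, f x) ^ a * (∫⁻ x, g x) ^ b ≤ ∫⁻ x, h x := by
  induction n with
  | zero =>
    rw [lintegral_unique, lintegral_unique, lintegral_unique]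
    have h0 : volume (univ : Set (Fin 0 → ℝ)) = 1 := by simp [volume_pi]
    rw [h0, mul_one, mul_one, mul_one]
    convert H default default
  | succ n ih =>
    have he := (volume_preserving_piFinSuccAbove (fun _ : Fin (n + 1) => ℝ) 0).symm
    set e := (MeasurableEquiv.piFinSuccAbove (fun _ : Fin (n + 1) => ℝ) 0).symm
    have split {f : (Fin (n + 1) → ℝ) → ℝ≥0∞} (hf : Measurable f) :
        ∫⁻ x, f x = ∫⁻ t, ∫⁻ y, f (e (t, y)) := by
      rw [← he.lintegral_comp hf]
      exact lintegral_prod _ (hf.comp e.measurable).aemeasurable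
    have hmeas {f : (Fin (n + 1) → ℝ) → ℝ≥0∞} (hf : Measurable f) (t : ℝ) :
        Measurable fun y => f (e (t, y)) := hf.comp (e.measurable.comp measurable_prodMk_left)
    have hmeas' {f : (Fin (n + 1) → ℝ) → ℝ≥0∞} (hf : Measurable f) :
        Measurable fun t => ∫⁻ y, f (e (t, y)) :=
      (hf.comp e.measurable).lintegral_prod_right'
    have hlin (s t : ℝ) (x y : Fin n → ℝ) :
        a • e (s, x) + b • e (t, y) = e (a * s + b * t, a • x + b • y) := by
      ext i
      refine Fin.cases ?_ (fun i => ?_) i <;> simp [e, MeasurableEquiv.piFinSuccAbove]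
    rw [split hf, split hg, split hh]
    refine prekopa_leindler_real ha hb hab (hmeas' hf) (hmeas' hg) (hmeas' hh) fun s t => ?_
    refine ih (hmeas hf s) (hmeas hg t) (hmeas hh _) fun x y => ?_
    rw [← hlin]
    exact H _ _

/-- The multiplicative Brunn–Minkowski inequality. -/
theorem volume_rpow_mul_volume_rpow_le {a b : ℝ} (ha : 0 < a) (hb : 0 < b) (hab : a + b = 1)
    {n : ℕ} {A B C : Set (EuclideanSpace ℝ (Fin n))} (hA : MeasurableSet A)
    (hB : MeasurableSet B) (hC : MeasurableSet C)
    (H : ∀ x ∈ A, ∀ y ∈ B, a • x + b • y ∈ C) :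
    volume A ^ a * volume B ^ b ≤ volume C := by
  have hφ := (PiLp.volume_preserving_toLp (Fin n))
  have hφm := hφ.measurable
  have key := prekopa_leindler ha hb hab n
    (f := (WithLp.toLp 2 ⁻¹' A).indicator 1) (g := (WithLp.toLp 2 ⁻¹' B).indicator 1)
    (h := (WithLp.toLp 2 ⁻¹' C).indicator 1)
    (measurable_one.indicator (hφm hA)) (measurable_one.indicator (hφm hB))
    (measurable_one.indicator (hφm hC)) ?_
  · rwa [lintegral_indicator_one (hφm hA), lintegral_indicator_one (hφm hB),
      lintegral_indicator_one (hφm hC), hφ.measure_preimage hA.nullMeasurableSet,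
      hφ.measure_preimage hB.nullMeasurableSet, hφ.measure_preimage hC.nullMeasurableSet] at key
  · intro x y
    by_cases hx : WithLp.toLp 2 x ∈ A
    · by_cases hy : WithLp.toLp 2 y ∈ B
      · have : WithLp.toLp 2 (a • x + b • y) ∈ C := H _ hx _ hy
        rw [indicator_of_mem (show a • x + b • y ∈ WithLp.toLp 2 ⁻¹' C from this),
          indicator_of_mem (show x ∈ WithLp.toLp 2 ⁻¹' A from hx),
          indicator_of_mem (show y ∈ WithLp.toLp 2 ⁻¹' B from hy)]
        simp
      · rw [indicator_of_notMem (show y ∉ WithLp.toLp 2 ⁻¹' B from hy)]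
        simp [hb]
    · rw [indicator_of_notMem (show x ∉ WithLp.toLp 2 ⁻¹' A from hx)]
      simp [ha]

theorem measure_setOf_measureReal_Ici_le (ν : Measure ℝ) [IsProbabilityMeasure ν] (u : ℝ) :
    ν {y | ν.real (Ici y) ≤ u} ≤ ENNReal.ofReal u := by
  have hanti : Antitone fun y => ν.real (Ici y) := fun s t hst =>
    measureReal_mono (Ici_subset_Ici.2 hst)
  rw [(measurableSet_le hanti.measurable measurable_const).measure_eq_iSup_isCompact]
  refine iSup_le fun K => iSup_le fun hK => iSup_le fun hKc => ?_
  rcases K.eq_empty_or_nonempty with rfl | hne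
  · simp
  obtain ⟨p, hpK, hp⟩ := hKc.exists_isLeast hne
  calc ν K ≤ ν (Ici p) := measure_mono fun x hx => hp hx
    _ = ENNReal.ofReal (ν.real (Ici p)) := by simp
    _ ≤ ENNReal.ofReal u := ENNReal.ofReal_le_ofReal (hK hpK)

theorem lintegral_ofReal_neg_log_measureReal_Ici_le (ν : Measure ℝ) [IsProbabilityMeasure ν] :
    ∫⁻ y, ENNReal.ofReal (-Real.log (ν.real (Ici y))) ∂ν ≤ 1 := by
  have hanti : Antitone fun y => ν.real (Ici y) := fun s t hst =>
    measureReal_mono (Ici_subset_Ici.2 hst)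
  have hnn y : 0 ≤ -Real.log (ν.real (Ici y)) :=
    neg_nonneg.2 (Real.log_nonpos measureReal_nonneg measureReal_le_one)
  rw [lintegral_eq_lintegral_meas_le ν (.of_forall hnn) hanti.measurable.log.neg.aemeasurable]
  calc ∫⁻ t in Ioi (0 : ℝ), ν {y | t ≤ -Real.log (ν.real (Ici y))}
      ≤ ∫⁻ t in Ioi (0 : ℝ), ENNReal.ofReal (Real.exp (-t)) := by
        refine setLIntegral_mono' measurableSet_Ioi fun t ht => ?_
        refine (measure_mono fun y hy => ?_).trans
          (measure_setOf_measureReal_Ici_le ν _)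
        simp only [mem_ofPred_eq] at hy ⊢
        rcases (measureReal_nonneg (μ := ν) (s := Ici y)).eq_or_lt with h0 | h0
        · rw [← h0]; positivity
        · rw [← Real.log_le_iff_le_exp h0]; linarith
    _ = 1 := by
        rw [← ofReal_integral_eq_lintegral_ofReal (integrableOn_exp_neg_Ioi 0)
          (.of_forall fun _ => Real.exp_nonneg _), integral_exp_neg_Ioi_zero, ENNReal.ofReal_one]

/-- Grünbaum's inequality for a centered probability measure on `ℝ` with log-concave tail. -/
theorem exp_neg_one_le_measureReal_Ici_zero (ν : Measure ℝ) [IsProbabilityMeasure ν]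
    (hint : Integrable (fun x => x) ν) (hmean : ∫ x, x ∂ν = 0)
    (hlc : ∀ a b : ℝ, 0 < a → 0 < b → a + b = 1 → ∀ s t : ℝ,
      ν.real (Ici s) ^ a * ν.real (Ici t) ^ b ≤ ν.real (Ici (a * s + b * t))) :
    Real.exp (-1) ≤ ν.real (Ici 0) := by
  have hanti : Antitone fun y => ν.real (Ici y) := fun s t hst =>
    measureReal_mono (Ici_subset_Ici.2 hst)
  by_cases hpos : ν (Ioi 0) = 0
  · have hle : ∀ᵐ x ∂ν, 0 ≤ -x := by
      filter_upwards [measure_eq_zero_iff_ae_notMem.1 hpos] with x hx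
      simpa using hx
    have h0 : ∀ᵐ x ∂ν, x ∈ Ici (0 : ℝ) := by
      have := (integral_eq_zero_iff_of_nonneg_ae hle hint.neg).1 (by
        rw [integral_neg, hmean, neg_zero])
      filter_upwards [this] with x hx
      have : -x = 0 := hx
      simp only [mem_Ici]; linarith
    have h1 : ν (Ici 0) = 1 := prob_compl_eq_zero_iff measurableSet_Ici |>.1 (by
      exact mem_ae_iff.1 h0)
    rw [measureReal_def, h1, ENNReal.toReal_one, Real.exp_le_one_iff]
    norm_num
  obtain ⟨ε, hε, hνε⟩ : ∃ ε : ℝ, 0 < ε ∧ 0 < ν.real (Ici ε) := by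
    by_contra! hcon
    refine hpos (measure_mono_null (t := ⋃ k : ℕ, Ici (1 / ((k : ℝ) + 1))) (fun x hx => ?_)
      (measure_iUnion_null fun k => ?_))
    · obtain ⟨k, hk⟩ := exists_nat_one_div_lt (show (0 : ℝ) < x from hx)
      exact mem_iUnion.2 ⟨k, hk.le⟩
    · exact (measureReal_eq_zero_iff).1 (le_antisymm (hcon _ (by positivity)) measureReal_nonneg)
  set φ : ℝ → ℝ := fun y => -Real.log (ν.real (Ici y)) with hφ
  set I : Set ℝ := {y | 0 < ν.real (Ici y)} with hI
  have hconv : ConvexOn ℝ I φ := by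
    have hmul {s t a b : ℝ} (hs : s ∈ I) (ht : t ∈ I) :
        0 < ν.real (Ici s) ^ a * ν.real (Ici t) ^ b :=
      mul_pos (Real.rpow_pos_of_pos hs _) (Real.rpow_pos_of_pos ht _)
    refine convexOn_iff_forall_pos.2 ⟨convex_iff_forall_pos.2 fun s hs t ht a b ha hb hab =>
      (hmul hs ht).trans_le (hlc a b ha hb hab s t), fun s hs t ht a b ha hb hab => ?_⟩
    have hlog := Real.log_le_log (hmul hs ht) (hlc a b ha hb hab s t)
    rw [Real.log_mul (Real.rpow_pos_of_pos hs _).ne' (Real.rpow_pos_of_pos ht _).ne',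
      Real.log_rpow hs, Real.log_rpow ht] at hlog
    simp only [hφ, smul_eq_mul]
    linarith
  have hmem : (0 : ℝ) ∈ interior I :=
    mem_interior.2 ⟨Iio ε, fun y hy => hνε.trans_le (hanti (le_of_lt hy)), isOpen_Iio, hε⟩
  obtain ⟨m, hm⟩ : ∃ m : ℝ, ∀ y ∈ I, φ 0 + m * y ≤ φ y := by
    refine ⟨derivWithin φ (Ioi 0) 0, fun y hy => ?_⟩
    rcases lt_trichotomy y 0 with h | rfl | h
    · have h1 := (hconv.slope_le_leftDeriv_of_mem_interior hy hmem h).trans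
        (hconv.leftDeriv_le_rightDeriv_of_mem_interior hmem)
      rw [slope_def_field, div_le_iff₀ (by linarith)] at h1
      linarith
    · simp
    · have h1 := hconv.rightDeriv_le_slope_of_mem_interior hmem hy h
      rw [slope_def_field, le_div_iff₀ (by linarith)] at h1
      linarith
  have hae : ∀ᵐ y ∂ν, y ∈ I := by
    have := measure_setOf_measureReal_Ici_le ν 0
    rw [ENNReal.ofReal_zero, nonpos_iff_eq_zero] at this
    simpa [ae_iff, hI] using this
  have hnn y : 0 ≤ φ y :=
    neg_nonneg.2 (Real.log_nonpos measureReal_nonneg measureReal_le_one)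
  have hφm : AEStronglyMeasurable φ ν := hanti.measurable.log.neg.aestronglyMeasurable
  have hle := lintegral_ofReal_neg_log_measureReal_Ici_le ν
  have hφint : Integrable φ ν :=
    ⟨hφm, (hasFiniteIntegral_iff_ofReal (.of_forall hnn)).2 (hle.trans_lt ENNReal.one_lt_top)⟩
  have h1 : ∫ y, φ y ∂ν ≤ 1 := by
    rw [integral_eq_lintegral_of_nonneg_ae (.of_forall hnn) hφm]
    exact ENNReal.toReal_le_of_le_ofReal zero_le_one (by simpa using hle)
  have h2 : ∫ y, (φ 0 + m * y) ∂ν ≤ ∫ y, φ y ∂ν :=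
    integral_mono_ae ((integrable_const _).add (hint.const_mul m)) hφint (hae.mono hm)
  rw [integral_add (integrable_const _) (hint.const_mul m), integral_const_mul, hmean] at h2
  simp only [integral_const, probReal_univ, smul_eq_mul, one_mul, mul_zero, add_zero] at h2
  have hpos0 : 0 < ν.real (Ici 0) := hνε.trans_le (hanti hε.le)
  rw [← Real.le_log_iff_exp_le hpos0]
  have : φ 0 = -Real.log (ν.real (Ici 0)) := rfl
  linarith

/-- Grünbaum-type lemma: if a compact convex set `K ⊆ ℝⁿ` of positive volume has its
center of gravity at the origin, then any halfspace through the origin contains at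
least a `1/e` fraction of the volume of `K`. -/
theorem stmt_0 (n : ℕ) (K : Set (EuclideanSpace ℝ (Fin n)))
    (hKcomp : IsCompact K) (hKconv : Convex ℝ K)
    (hKpos : 0 < volume K)
    (hcog : (∫ x in K, x ∂volume) = 0)
    (w : EuclideanSpace ℝ (Fin n)) (hw : w ≠ 0) :
    ENNReal.ofReal (1 / Real.exp 1) * volume K ≤
      volume (K ∩ {x : EuclideanSpace ℝ (Fin n) | 0 ≤ ⟪w, x⟫}) := by
  have hVtop : volume K ≠ ∞ := hKcomp.measure_lt_top.ne
  have hL : Measurable fun x : EuclideanSpace ℝ (Fin n) => ⟪w, x⟫ :=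
    (continuous_const.inner continuous_id).measurable
  have hKint : IntegrableOn (fun x => x) K :=
    continuous_id.continuousOn.integrableOn_compact hKcomp
  set μ := (volume K)⁻¹ • volume.restrict K with hμ
  have hμprob : IsProbabilityMeasure μ := ⟨by
    simp [hμ, ENNReal.inv_mul_cancel hKpos.ne' hVtop]⟩
  have hμint : Integrable (fun x => x) μ := hKint.smul_measure (by simpa using hKpos.ne')
  set ν := μ.map fun x => ⟪w, x⟫ with hν
  have : IsProbabilityMeasure ν := Measure.isProbabilityMeasure_map hL.aemeasurable
  have hIci t : ν (Ici t) = (volume K)⁻¹ * volume (K ∩ {x | t ≤ ⟪w, x⟫}) := by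
    rw [hν, Measure.map_apply hL measurableSet_Ici, hμ, Measure.smul_apply, smul_eq_mul,
      Measure.restrict_apply (hL measurableSet_Ici), inter_comm]
    rfl
  have hmeas t : MeasurableSet (K ∩ {x | t ≤ ⟪w, x⟫}) :=
    hKcomp.measurableSet.inter (measurableSet_le measurable_const hL)
  have key := exp_neg_one_le_measureReal_Ici_zero ν
    ((integrable_map_measure aestronglyMeasurable_id hL.aemeasurable).2 (hμint.const_inner w))
    (by
      rw [hν, integral_map (f := fun x => x) hL.aemeasurable aestronglyMeasurable_id,
        integral_inner hμint, hμ, integral_smul_measure, hcog, smul_zero, inner_zero_right])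
    fun a b ha hb hab s t => by
      have hbm := volume_rpow_mul_volume_rpow_le ha hb hab (hmeas s) (hmeas t)
        (hmeas (a * s + b * t)) fun x hx y hy => ⟨hKconv hx.1 hy.1 ha.le hb.le hab, by
          have h1 : s ≤ ⟪w, x⟫ := hx.2
          have h2 : t ≤ ⟪w, y⟫ := hy.2
          simp only [mem_ofPred_eq, inner_add_right, inner_smul_right]
          gcongr⟩
      rw [measureReal_def, measureReal_def, measureReal_def, ENNReal.toReal_rpow,
        ENNReal.toReal_rpow, ← ENNReal.toReal_mul]
      refine ENNReal.toReal_mono (measure_ne_top _ _) ?_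
      rw [hIci, hIci, hIci, ENNReal.mul_rpow_of_nonneg _ _ ha.le,
        ENNReal.mul_rpow_of_nonneg _ _ hb.le, mul_mul_mul_comm,
        ← ENNReal.rpow_add_of_nonneg _ _ ha.le hb.le, hab, ENNReal.rpow_one]
      gcongr
  rw [measureReal_def, ← ENNReal.ofReal_le_iff_le_toReal (measure_ne_top _ _), hIci,
    ← ENNReal.div_eq_inv_mul, ENNReal.le_div_iff_mul_le (.inl hKpos.ne') (.inl hVtop)] at key
  rwa [one_div, ← Real.exp_neg]
end

section
/- Let X ⊂ ℝⁿ be a compact convex set with nonempty interior and let f : X → ℝ be a continuous convex function with |f(x)| ≤ B for all x ∈ X. Define S₁ = X and, for t ≥ 1: c_t = (1/vol(S_t)) ∫_{S_t} x dx (the center of gravity of S_t), w_t any subgradient of f at c_t (with respect to X), and S_{t+1} = S_t ∩ {x ∈ ℝⁿ : ⟪w_t, x - c_t⟫ ≤ 0}. Then for every t ≥ 1, min_{1 ≤ r ≤ t} f(c_r) - inf_{x ∈ X} f(x) ≤ 2B·(1 - 1/e)^{t/n}. -/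
open MeasureTheory
open scoped RealInnerProductSpace ENNReal

theorem volume_add_le_of_isCompact {A B C : Set ℝ} (hA : IsCompact A) (hB : IsCompact B)
    (hA₀ : A.Nonempty) (hB₀ : B.Nonempty) (hC : ∀ a ∈ A, ∀ b ∈ B, a + b ∈ C) :
    volume A + volume B ≤ volume C := by
  obtain ⟨a, ha, ha'⟩ := hA.exists_isGreatest hA₀
  obtain ⟨b, hb, hb'⟩ := hB.exists_isLeast hB₀
  have hinter : volume (((fun x => x + b) '' A) ∩ ((fun x => a + x) '' B)) = 0 := by
    refine measure_mono_null (t := {a + b}) ?_ (by simp)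
    rintro _ ⟨⟨x, hx, rfl⟩, ⟨y, hy, hxy⟩⟩
    have := ha' hx
    have := hb' hy
    simp only [Set.mem_singleton_iff] at *
    linarith
  calc volume A + volume B
      = volume ((fun x => x + b) '' A) + volume ((fun x => a + x) '' B) := by
        rw [Set.image_add_right, Set.image_add_left, measure_preimage_add_right,
          measure_preimage_add]
    _ = volume (((fun x => x + b) '' A) ∪ ((fun x => a + x) '' B)) := by
        rw [← measure_union_add_inter _ (hB.image (by fun_prop)).measurableSet, hinter, add_zero]
    _ ≤ volume C := by
        refine measure_mono ?_
        rintro _ (⟨x, hx, rfl⟩ | ⟨x, hx, rfl⟩)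
        exacts [hC _ hx _ hb, hC _ ha _ hx]

theorem volume_add_le_of_measurableSet {A B C : Set ℝ} (hA : MeasurableSet A)
    (hB : MeasurableSet B) (hA₀ : A.Nonempty) (hB₀ : B.Nonempty)
    (hC : ∀ a ∈ A, ∀ b ∈ B, a + b ∈ C) :
    volume A + volume B ≤ volume C := by
  obtain ⟨a, ha⟩ := hA₀
  obtain ⟨b, hb⟩ := hB₀
  rw [hA.measure_eq_iSup_isCompact, hB.measure_eq_iSup_isCompact]
  simp only [iSup_and']
  refine ENNReal.biSup_add_biSup_le' ⟨∅, by simp⟩ ⟨∅, by simp⟩ fun K hK L hL => ?_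
  calc volume K + volume L ≤ volume (insert a K) + volume (insert b L) := by
        gcongr <;> exact Set.subset_insert _ _
    _ ≤ volume C := by
        refine volume_add_le_of_isCompact (hK.2.insert a) (hL.2.insert b)
          (Set.insert_nonempty _ _) (Set.insert_nonempty _ _) fun x hx y hy => ?_
        exact hC _ (Set.insert_subset ha hK.1 hx) _ (Set.insert_subset hb hL.1 hy)

theorem ENNReal.geom_mean_le_arith_mean2_weighted {p q : ℝ} (hp : 0 < p) (hq : 0 < q)
    (hpq : p + q = 1) (a b : ℝ≥0∞) :
    a ^ p * b ^ q ≤ ENNReal.ofReal p * a + ENNReal.ofReal q * b := by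
  induction a with
  | top => simp [ENNReal.mul_top, hp]
  | coe a =>
    induction b with
    | top => simp [ENNReal.mul_top, hq]
    | coe b =>
      have := NNReal.geom_mean_le_arith_mean2_weighted p.toNNReal q.toNNReal a b
        (by rw [← Real.toNNReal_add hp.le hq.le, hpq, Real.toNNReal_one])
      rw [Real.coe_toNNReal _ hp.le, Real.coe_toNNReal _ hq.le] at this
      rw [← ENNReal.coe_rpow_of_nonneg _ hp.le, ← ENNReal.coe_rpow_of_nonneg _ hq.le,
        ENNReal.ofReal, ENNReal.ofReal]
      exact_mod_cast this

theorem volume_convexCombo_le {A B C : Set ℝ} {p q : ℝ} (hp : 0 < p) (hq : 0 < q)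
    (hA : MeasurableSet A) (hB : MeasurableSet B) (hA₀ : A.Nonempty) (hB₀ : B.Nonempty)
    (hC : ∀ a ∈ A, ∀ b ∈ B, p * a + q * b ∈ C) :
    ENNReal.ofReal p * volume A + ENNReal.ofReal q * volume B ≤ volume C := by
  have := volume_add_le_of_measurableSet (C := C) (hA.const_smul₀ p) (hB.const_smul₀ q)
    (hA₀.image _) (hB₀.image _) (by
      rintro _ ⟨a, ha, rfl⟩ _ ⟨b, hb, rfl⟩
      exact hC a ha b hb)
  simpa [Measure.addHaar_smul, abs_of_pos hp, abs_of_pos hq] using this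

theorem prekopa_leindler_of_sup_eq_one {f g h : ℝ → ℝ} {p q : ℝ} (hp : 0 < p) (hq : 0 < q)
    (hpq : p + q = 1) (hf : Measurable f) (hg : Measurable g) (hh : Measurable h)
    (hf₀ : 0 ≤ f) (hg₀ : 0 ≤ g) (hh₀ : 0 ≤ h)
    (hf₁ : IsLUB (Set.range f) 1) (hg₁ : IsLUB (Set.range g) 1)
    (hfgh : ∀ x y, f x ^ p * g y ^ q ≤ h (p * x + q * y)) :
    (∫⁻ x, ENNReal.ofReal (f x)) ^ p * (∫⁻ x, ENNReal.ofReal (g x)) ^ q ≤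
      ∫⁻ x, ENNReal.ofReal (h x) := by
  refine (ENNReal.geom_mean_le_arith_mean2_weighted hp hq hpq _ _).trans ?_
  rw [lintegral_eq_lintegral_meas_lt _ (.of_forall hf₀) hf.aemeasurable,
    lintegral_eq_lintegral_meas_lt _ (.of_forall hg₀) hg.aemeasurable,
    lintegral_eq_lintegral_meas_lt _ (.of_forall hh₀) hh.aemeasurable,
    ← lintegral_const_mul' _ _ ENNReal.ofReal_ne_top,
    ← lintegral_const_mul' _ _ ENNReal.ofReal_ne_top, ← lintegral_add_left]
  swap
  · refine Measurable.const_mul (Antitone.measurable fun s t hst => measure_mono ?_) _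
    exact fun x hx => hst.trans_lt hx
  refine setLIntegral_mono' measurableSet_Ioi fun t (ht : 0 < t) => ?_
  rcases lt_or_ge t 1 with ht₁ | ht₁
  · refine volume_convexCombo_le hp hq (measurableSet_lt measurable_const hf)
      (measurableSet_lt measurable_const hg) ?_ ?_ fun x hx y hy => ?_
    · obtain ⟨_, ⟨x, rfl⟩, hx, -⟩ := hf₁.exists_between ht₁
      exact ⟨x, hx⟩
    · obtain ⟨_, ⟨x, rfl⟩, hx, -⟩ := hg₁.exists_between ht₁
      exact ⟨x, hx⟩
    · calc t = t ^ p * t ^ q := by rw [← Real.rpow_add ht, hpq, Real.rpow_one]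
        _ < f x ^ p * g y ^ q := by
          have := Real.rpow_lt_rpow ht.le hx hp
          have := Real.rpow_lt_rpow ht.le hy hq
          gcongr
        _ ≤ _ := hfgh x y
  · have h₁ : {x | t < f x} = ∅ := by
      ext x; simpa using (hf₁.1 ⟨x, rfl⟩).trans ht₁
    have h₂ : {x | t < g x} = ∅ := by
      ext x; simpa using (hg₁.1 ⟨x, rfl⟩).trans ht₁
    simp [h₁, h₂]

/-- One-dimensional Prékopa–Leindler inequality for bounded functions. -/
theorem prekopa_leindler_s1 {f g h : ℝ → ℝ} {p q : ℝ} (hp : 0 < p) (hq : 0 < q)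
    (hpq : p + q = 1) (hf : Measurable f) (hg : Measurable g) (hh : Measurable h)
    (hf₀ : 0 ≤ f) (hg₀ : 0 ≤ g) (hh₀ : 0 ≤ h)
    (hf₁ : BddAbove (Set.range f)) (hg₁ : BddAbove (Set.range g))
    (hfgh : ∀ x y, f x ^ p * g y ^ q ≤ h (p * x + q * y)) :
    (∫⁻ x, ENNReal.ofReal (f x)) ^ p * (∫⁻ x, ENNReal.ofReal (g x)) ^ q ≤
      ∫⁻ x, ENNReal.ofReal (h x) := by
  have key : ∀ u : ℝ → ℝ, 0 ≤ u → BddAbove (Set.range u) → u = 0 ∨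
      ∃ M > 0, IsLUB (Set.range fun x => M⁻¹ * u x) 1 := by
    intro u hu hb
    have hlub := isLUB_ciSup hb
    rcases (hu 0).trans (hlub.1 ⟨0, rfl⟩) |>.eq_or_lt with h0 | h0
    · left
      funext x
      exact le_antisymm ((hlub.1 ⟨x, rfl⟩).trans h0.ge) (hu x)
    · refine .inr ⟨_, h0, ?_, ?_⟩
      · rintro _ ⟨x, rfl⟩
        have := hlub.1 ⟨x, rfl⟩
        simp only [inv_mul_le_iff₀ h0, mul_one]
        exact this
      · intro b hb
        rw [← inv_mul_cancel₀ h0.ne', inv_mul_le_iff₀ h0]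
        refine hlub.2 ?_
        rintro _ ⟨x, rfl⟩
        rw [← inv_mul_le_iff₀ h0]
        exact hb ⟨x, rfl⟩
  rcases key f hf₀ hf₁ with rfl | ⟨M, hM, hM₁⟩
  · simp [hp]
  rcases key g hg₀ hg₁ with rfl | ⟨N, hN, hN₁⟩
  · simp [hq]
  have hL : 0 < M ^ p * N ^ q := by positivity
  have := prekopa_leindler_of_sup_eq_one (h := fun x => (M ^ p * N ^ q)⁻¹ * h x) hp hq hpq
    (hf.const_mul M⁻¹) (hg.const_mul N⁻¹) (hh.const_mul _)
    (fun x => mul_nonneg (by positivity) (hf₀ x)) (fun x => mul_nonneg (by positivity) (hg₀ x))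
    (fun x => mul_nonneg (by positivity) (hh₀ x)) hM₁ hN₁ (by
      intro x y
      rw [Real.mul_rpow (by positivity) (hf₀ x), Real.mul_rpow (by positivity) (hg₀ y),
        Real.inv_rpow hM.le, Real.inv_rpow hN.le, mul_inv, mul_mul_mul_comm]
      exact mul_le_mul_of_nonneg_left (hfgh x y) (by positivity))
  have hi : ∀ {c : ℝ}, 0 < c → ENNReal.ofReal c⁻¹ ≠ 0 := fun hc => by simpa using hc
  simp only [ENNReal.ofReal_mul (inv_nonneg.2 hM.le), ENNReal.ofReal_mul (inv_nonneg.2 hN.le),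
    ENNReal.ofReal_mul (inv_nonneg.2 hL.le)] at this
  rw [lintegral_const_mul' _ _ ENNReal.ofReal_ne_top, lintegral_const_mul' _ _ ENNReal.ofReal_ne_top,
    lintegral_const_mul' _ _ ENNReal.ofReal_ne_top, ENNReal.mul_rpow_of_nonneg _ _ hp.le,
    ENNReal.mul_rpow_of_nonneg _ _ hq.le, mul_mul_mul_comm,
    ENNReal.ofReal_rpow_of_pos (by positivity), ENNReal.ofReal_rpow_of_pos (by positivity),
    ← ENNReal.ofReal_mul (by positivity), Real.inv_rpow hM.le, Real.inv_rpow hN.le, ← mul_inv,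
    ENNReal.mul_le_mul_iff_right (hi hL) ENNReal.ofReal_ne_top] at this
  exact this

/-- Multiplicative Brunn–Minkowski inequality for bounded measurable sets. -/
theorem brunn_minkowski_pi {p q : ℝ} (hp : 0 < p) (hq : 0 < q) (hpq : p + q = 1) (R : ℝ) (n : ℕ)
    {A B C : Set (Fin n → ℝ)} (hA : MeasurableSet A) (hB : MeasurableSet B)
    (hC : MeasurableSet C) (hAR : ∀ x ∈ A, ‖x‖ ≤ R) (hBR : ∀ x ∈ B, ‖x‖ ≤ R)
    (hCR : ∀ x ∈ C, ‖x‖ ≤ R) (hABC : ∀ a ∈ A, ∀ b ∈ B, p • a + q • b ∈ C) :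
    volume A ^ p * volume B ^ q ≤ volume C := by
  induction n with
  | zero =>
    rcases A.eq_empty_or_nonempty with rfl | ⟨a, ha⟩
    · simp [hp]
    rcases B.eq_empty_or_nonempty with rfl | ⟨b, hb⟩
    · simp [hq]
    rw [Subsingleton.eq_univ_of_nonempty ⟨_, ha⟩, Subsingleton.eq_univ_of_nonempty ⟨_, hb⟩,
      Subsingleton.eq_univ_of_nonempty ⟨_, hABC a ha b hb⟩]
    simp [volume_pi]
  | succ n ih =>
    let e := (MeasurableEquiv.piFinSuccAbove (fun _ : Fin (n + 1) => ℝ) 0).symm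
    have he : ∀ x y, e (x, y) = Fin.cons x y := fun x y => by
      simp [e, MeasurableEquiv.piFinSuccAbove, Fin.insertNthEquiv]
    let σ : Set (Fin (n + 1) → ℝ) → ℝ → Set (Fin n → ℝ) := fun D x => Prod.mk x ⁻¹' (e ⁻¹' D)
    have hσ : ∀ D x y, y ∈ σ D x ↔ (Fin.cons x y : Fin (n + 1) → ℝ) ∈ D := fun D x y => by
      simp [σ, he]
    have hσm : ∀ D, MeasurableSet D → ∀ x, MeasurableSet (σ D x) := fun D hD x =>
      measurable_prodMk_left (e.measurable hD)
    have hσR : ∀ D : Set (Fin (n + 1) → ℝ), (∀ x ∈ D, ‖x‖ ≤ R) → ∀ x, ∀ y ∈ σ D x, ‖y‖ ≤ R := by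
      intro D hD x y hy
      have := hD _ ((hσ D x y).1 hy)
      have hR := (norm_nonneg _).trans this
      rw [pi_norm_le_iff_of_nonneg hR] at this ⊢
      intro i
      simpa using this i.succ
    have hball : volume (Metric.closedBall (0 : Fin n → ℝ) R) ≠ ⊤ :=
      (isCompact_closedBall _ _).measure_ne_top
    have hle : ∀ D : Set (Fin (n + 1) → ℝ), (∀ x ∈ D, ‖x‖ ≤ R) → ∀ x,
        volume (σ D x) ≤ volume (Metric.closedBall (0 : Fin n → ℝ) R) := fun D hD x =>
      measure_mono fun y hy => by simpa using hσR D hD x y hy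
    have hfin : ∀ D : Set (Fin (n + 1) → ℝ), (∀ x ∈ D, ‖x‖ ≤ R) → ∀ x, volume (σ D x) ≠ ⊤ :=
      fun D hD x => ne_top_of_le_ne_top hball (hle D hD x)
    have hvol : ∀ D : Set (Fin (n + 1) → ℝ), MeasurableSet D → (∀ x ∈ D, ‖x‖ ≤ R) →
        volume D = ∫⁻ x, ENNReal.ofReal (volume (σ D x)).toReal := by
      intro D hD hDR
      rw [← ((volume_preserving_piFinSuccAbove (fun _ : Fin (n + 1) => ℝ) 0).symm
        _).measure_preimage hD.nullMeasurableSet, Measure.volume_eq_prod,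
        Measure.prod_apply (e.measurable hD)]
      exact lintegral_congr fun x => (ENNReal.ofReal_toReal (hfin D hDR x)).symm
    have hmeas : ∀ D, MeasurableSet D → Measurable fun x => (volume (σ D x)).toReal :=
      fun D hD => (measurable_measure_prodMk_left (e.measurable hD)).ennreal_toReal
    have hbdd : ∀ D : Set (Fin (n + 1) → ℝ), (∀ x ∈ D, ‖x‖ ≤ R) →
        BddAbove (Set.range fun x => (volume (σ D x)).toReal) := by
      rintro D hD
      refine ⟨(volume (Metric.closedBall (0 : Fin n → ℝ) R)).toReal, ?_⟩
      rintro _ ⟨x, rfl⟩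
      exact ENNReal.toReal_mono hball (hle D hD x)
    rw [hvol A hA hAR, hvol B hB hBR, hvol C hC hCR]
    refine prekopa_leindler_s1 hp hq hpq (hmeas A hA) (hmeas B hB) (hmeas C hC)
      (fun _ => ENNReal.toReal_nonneg) (fun _ => ENNReal.toReal_nonneg)
      (fun _ => ENNReal.toReal_nonneg) (hbdd A hAR) (hbdd B hBR) fun x y => ?_
    rw [ENNReal.toReal_rpow, ENNReal.toReal_rpow, ← ENNReal.toReal_mul]
    refine ENNReal.toReal_mono (hfin C hCR _) ?_
    refine ih (hσm A hA x) (hσm B hB y) (hσm C hC _) (hσR A hAR x) (hσR B hBR y) (hσR C hCR _) ?_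
    intro a ha b hb
    rw [hσ] at ha hb ⊢
    convert hABC _ ha _ hb using 1
    ext i
    refine Fin.cases ?_ (fun i => ?_) i <;> simp

theorem brunn_minkowski {p q : ℝ} (hp : 0 < p) (hq : 0 < q) (hpq : p + q = 1) {n : ℕ}
    {A B C : Set (EuclideanSpace ℝ (Fin n))} (hA : IsCompact A) (hB : IsCompact B)
    (hC : IsCompact C) (hABC : ∀ a ∈ A, ∀ b ∈ B, p • a + q • b ∈ C) :
    volume A ^ p * volume B ^ q ≤ volume C := by
  have hm := PiLp.volume_preserving_toLp (Fin n)
  have hc : ∀ {D : Set (EuclideanSpace ℝ (Fin n))}, IsCompact D →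
      IsCompact ((WithLp.toLp 2 : (Fin n → ℝ) → _) ⁻¹' D) := fun hD =>
    (EuclideanSpace.equiv (Fin n) ℝ).symm.toHomeomorph.isCompact_preimage.2 hD
  obtain ⟨R, hR⟩ := (((hc hA).union (hc hB)).union (hc hC)).isBounded.exists_norm_le
  rw [← hm.measure_preimage hA.measurableSet.nullMeasurableSet,
    ← hm.measure_preimage hB.measurableSet.nullMeasurableSet,
    ← hm.measure_preimage hC.measurableSet.nullMeasurableSet]
  exact brunn_minkowski_pi hp hq hpq R n (hc hA).measurableSet (hc hB).measurableSet
    (hc hC).measurableSet (fun x hx => hR x (.inl (.inl hx))) (fun x hx => hR x (.inl (.inr hx)))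
    (fun x hx => hR x (.inr hx)) fun a ha b hb => hABC _ ha _ hb

theorem measure_cdf_lt_le (ν : Measure ℝ) [IsProbabilityMeasure ν] (u : ℝ) :
    ν {x | ν.real (Set.Iic x) < u} ≤ ENNReal.ofReal u := by
  have hmono : Monotone fun x => ν.real (Set.Iic x) := fun x y h =>
    measureReal_mono (Set.Iic_subset_Iic.2 h)
  rw [(measurableSet_lt hmono.measurable measurable_const).measure_eq_iSup_isCompact]
  refine iSup₂_le fun K hK => iSup_le fun hKc => ?_
  rcases K.eq_empty_or_nonempty with rfl | hK₀
  · simp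
  obtain ⟨k, hk, hk'⟩ := hKc.exists_isGreatest hK₀
  calc ν K ≤ ν (Set.Iic k) := measure_mono fun x hx => hk' hx
    _ = ENNReal.ofReal (ν.real (Set.Iic k)) := (ofReal_measureReal).symm
    _ ≤ ENNReal.ofReal u := ENNReal.ofReal_le_ofReal (hK hk).le

theorem ae_cdf_pos (ν : Measure ℝ) [IsProbabilityMeasure ν] :
    ∀ᵐ x ∂ν, 0 < ν.real (Set.Iic x) := by
  rw [ae_iff]
  refine le_antisymm (le_of_forall_pos_le_add fun u hu => ?_) zero_le
  rcases eq_or_ne u ⊤ with rfl | hu'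
  · simp
  rw [zero_add, ← ENNReal.ofReal_toReal hu']
  refine (measure_mono fun x hx => ?_).trans (measure_cdf_lt_le ν u.toReal)
  exact (not_lt.1 hx).trans_lt (ENNReal.toReal_pos hu.ne' hu')

theorem lintegral_neg_log_cdf_le (ν : Measure ℝ) [IsProbabilityMeasure ν] :
    ∫⁻ x, ENNReal.ofReal (-Real.log (ν.real (Set.Iic x))) ∂ν ≤ 1 := by
  have hmono : Monotone fun x => ν.real (Set.Iic x) := fun x y h =>
    measureReal_mono (Set.Iic_subset_Iic.2 h)
  rw [lintegral_eq_lintegral_meas_lt ν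
    (.of_forall fun x => neg_nonneg.2 (Real.log_nonpos measureReal_nonneg measureReal_le_one))
    (Real.measurable_log.comp hmono.measurable).neg.aemeasurable]
  calc ∫⁻ t in Set.Ioi 0, ν {x | t < -Real.log (ν.real (Set.Iic x))}
      ≤ ∫⁻ t in Set.Ioi 0, ENNReal.ofReal (Real.exp (-t)) := by
        refine setLIntegral_mono' measurableSet_Ioi fun t (ht : 0 < t) => ?_
        refine (measure_mono fun x hx => ?_).trans (measure_cdf_lt_le ν _)
        simp only [Set.mem_ofPred_eq] at hx ⊢
        rcases (measureReal_nonneg (μ := ν) (s := Set.Iic x)).eq_or_lt with h | h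
        · rw [← h]; positivity
        · rw [← Real.log_lt_iff_lt_exp h]; linarith
    _ = 1 := by
        rw [← ofReal_integral_eq_lintegral_ofReal (integrableOn_exp_neg_Ioi 0)
          (.of_forall fun x => (Real.exp_pos _).le), integral_exp_neg_Ioi_zero, ENNReal.ofReal_one]

theorem ConvexOn.exists_affine_le_of_mem_interior {S : Set ℝ} {f : ℝ → ℝ} (hf : ConvexOn ℝ S f)
    {m : ℝ} (hm : m ∈ interior S) : ∃ a, ∀ x ∈ S, f m + a * (x - m) ≤ f x := by
  refine ⟨derivWithin f (Set.Ioi m) m, fun x hx => ?_⟩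
  rcases lt_trichotomy x m with h | rfl | h
  · have := (hf.slope_le_leftDeriv_of_mem_interior hx hm h).trans
      (hf.leftDeriv_le_rightDeriv_of_mem_interior hm)
    rw [slope_def_field, div_le_iff₀ (by linarith)] at this
    linarith
  · simp
  · have := hf.rightDeriv_le_slope_of_mem_interior hm hx h
    rw [slope_def_field, le_div_iff₀ (by linarith)] at this
    linarith

/-- A probability measure on the line with log-concave distribution function gives mass at least
`exp (-1)` to the half-line to the left of its mean. -/
theorem exp_neg_one_le_measure_Iic_mean (ν : Measure ℝ) [IsProbabilityMeasure ν]
    (hint : Integrable (fun x => x) ν)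
    (hlc : ∀ p q : ℝ, 0 < p → 0 < q → p + q = 1 → ∀ a b,
      ν (Set.Iic a) ^ p * ν (Set.Iic b) ^ q ≤ ν (Set.Iic (p * a + q * b))) :
    Real.exp (-1) ≤ ν.real (Set.Iic (∫ x, x ∂ν)) := by
  set m := ∫ x, x ∂ν with hm
  set F : ℝ → ℝ := fun x => ν.real (Set.Iic x) with hF
  have hmono : Monotone F := fun x y h => measureReal_mono (Set.Iic_subset_Iic.2 h)
  have hlc' : ∀ p q : ℝ, 0 < p → 0 < q → p + q = 1 → ∀ a b,
      F a ^ p * F b ^ q ≤ F (p * a + q * b) := by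
    intro p q hp hq hpq a b
    simp only [hF, measureReal_def, ENNReal.toReal_rpow, ← ENNReal.toReal_mul]
    exact ENNReal.toReal_mono (measure_ne_top _ _) (hlc p q hp hq hpq a b)
  have hsub : Integrable (fun x => x - m) ν := hint.sub (integrable_const m)
  by_cases hleft : ∃ s < m, 0 < F s
  · obtain ⟨s, hsm, hs⟩ := hleft
    have hconv : ConvexOn ℝ {x | 0 < F x} fun x => -Real.log (F x) := by
      rw [convexOn_iff_forall_pos]
      refine ⟨Set.OrdConnected.convex ⟨fun x hx y _ z hz => hx.trans_le (hmono hz.1)⟩, ?_⟩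
      intro x (hx : 0 < F x) y (hy : 0 < F y) p q hp hq hpq
      have := Real.log_le_log (by positivity) (hlc' p q hp hq hpq x y)
      rw [Real.log_mul (by positivity) (by positivity), Real.log_rpow hx, Real.log_rpow hy] at this
      simp only [smul_eq_mul]
      linarith
    have hmi : m ∈ interior {x | 0 < F x} :=
      mem_interior.2 ⟨Set.Ioi s, fun x hx => hs.trans_le (hmono (le_of_lt hx)), isOpen_Ioi, hsm⟩
    obtain ⟨a, ha⟩ := hconv.exists_affine_le_of_mem_interior hmi
    have hnn : ∀ x, 0 ≤ -Real.log (F x) := fun x =>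
      neg_nonneg.2 (Real.log_nonpos measureReal_nonneg measureReal_le_one)
    have hmeas : AEStronglyMeasurable (fun x => -Real.log (F x)) ν :=
      (Real.measurable_log.comp hmono.measurable).neg.aestronglyMeasurable
    have hle := lintegral_neg_log_cdf_le ν
    have hlogint : Integrable (fun x => -Real.log (F x)) ν := by
      refine ⟨hmeas, ?_⟩
      rw [hasFiniteIntegral_iff_ofReal (.of_forall hnn)]
      exact hle.trans_lt ENNReal.one_lt_top
    have h1 : ∫ x, -Real.log (F x) ∂ν ≤ 1 := by
      rw [integral_eq_lintegral_of_nonneg_ae (.of_forall hnn) hmeas]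
      exact ENNReal.toReal_le_of_le_ofReal zero_le_one (by simpa using hle)
    have h2 : ∫ x, (-Real.log (F m) + a * (x - m)) ∂ν ≤ ∫ x, -Real.log (F x) ∂ν := by
      refine integral_mono_ae ?_ hlogint ?_
      · exact (integrable_const _).add (hsub.const_mul _)
      · filter_upwards [ae_cdf_pos ν] with x hx using ha x hx
    rw [integral_add (integrable_const _) (hsub.const_mul _),
      integral_const_mul, integral_sub hint (integrable_const _)] at h2
    simp only [integral_const, probReal_univ, one_smul, ← hm, sub_self, mul_zero, add_zero] at h2
    rw [← Real.le_log_iff_exp_le (hs.trans_le (hmono hsm.le))]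
    linarith
  · push Not at hleft
    have hge : ∀ᵐ x ∂ν, m ≤ x := by
      filter_upwards [ae_cdf_pos ν] with x hx
      by_contra! h
      exact (hleft x h).not_gt hx
    have h0 : ∫ x, (x - m) ∂ν = 0 := by
      rw [integral_sub hint (integrable_const _)]
      simp [← hm]
    rw [integral_eq_zero_iff_of_nonneg_ae (by filter_upwards [hge] with x hx; simpa using hx)
      hsub] at h0
    have h1 : ν (Set.Iic m) = 1 := by
      rw [prob_compl_eq_zero_iff measurableSet_Iic |>.symm]
      refine (ae_iff (p := fun x => x ≤ m)).1 ?_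
      filter_upwards [h0] with x hx
      simp only [Pi.zero_apply] at hx
      linarith
    simp [measureReal_def, h1]

/-- **Grünbaum's inequality**: a halfspace whose boundary passes through the center of gravity of a
convex body contains at least a fraction `exp (-1)` of its volume. -/
theorem grunbaum {n : ℕ} {K : Set (EuclideanSpace ℝ (Fin n))} (hK : IsCompact K)
    (hKc : Convex ℝ K) (hK₀ : volume K ≠ 0) (v : EuclideanSpace ℝ (Fin n)) :
    Real.exp (-1) * volume.real K ≤
      volume.real (K ∩ {x | ⟪v, x - (volume K).toReal⁻¹ • ∫ y in K, y⟫ ≤ 0}) := by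
  have hV : volume K ≠ ⊤ := hK.measure_ne_top
  have hV' : 0 < volume.real K := ENNReal.toReal_pos hK₀ hV
  set ℓ : EuclideanSpace ℝ (Fin n) → ℝ := fun x => ⟪v, x⟫ with hℓ
  have hℓc : Continuous ℓ := by fun_prop
  set μ := (volume K)⁻¹ • volume.restrict K with hμ
  have : IsProbabilityMeasure μ := ⟨by simp [hμ, ENNReal.inv_mul_cancel hK₀ hV]⟩
  have : IsProbabilityMeasure (μ.map ℓ) := Measure.isProbabilityMeasure_map hℓc.aemeasurable
  have hIic : ∀ s, (μ.map ℓ) (Set.Iic s) = (volume K)⁻¹ * volume (K ∩ {x | ℓ x ≤ s}) := by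
    intro s
    rw [Measure.map_apply hℓc.measurable measurableSet_Iic, hμ, Measure.smul_apply, smul_eq_mul,
      Measure.restrict_apply (hℓc.measurable measurableSet_Iic), Set.inter_comm]
    rfl
  have hcomp : ∀ s, IsCompact (K ∩ {x | ℓ x ≤ s}) := fun s =>
    hK.inter_right (isClosed_le hℓc continuous_const)
  have hidK : Integrable (fun x : EuclideanSpace ℝ (Fin n) => x) (volume.restrict K) :=
    continuous_id.continuousOn.integrableOn_compact hK
  have hmean : ∫ x, x ∂(μ.map ℓ) = ℓ ((volume K).toReal⁻¹ • ∫ y in K, y) := by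
    rw [integral_map hℓc.aemeasurable (by fun_prop), hμ, integral_smul_measure, ENNReal.toReal_inv,
      hℓ]
    simp only [inner_smul_right, smul_eq_mul]
    rw [integral_inner hidK]
  have hint : Integrable (fun x => x) (μ.map ℓ) := by
    rw [integrable_map_measure (by fun_prop) hℓc.aemeasurable]
    exact (hℓc.continuousOn.integrableOn_compact hK).smul_measure (ENNReal.inv_ne_top.2 hK₀)
  have key := exp_neg_one_le_measure_Iic_mean (μ.map ℓ) hint (by
    intro p q hp hq hpq a b
    have hbm := brunn_minkowski hp hq hpq (hcomp a) (hcomp b) (hcomp (p * a + q * b)) (by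
      rintro x ⟨hx, hxa⟩ y ⟨hy, hyb⟩
      refine ⟨hKc hx hy hp.le hq.le hpq, ?_⟩
      simp only [hℓ, Set.mem_ofPred_eq, inner_add_right, inner_smul_right] at hxa hyb ⊢
      gcongr)
    have hinv : ((volume K)⁻¹) ^ p * ((volume K)⁻¹) ^ q = (volume K)⁻¹ := by
      rw [← ENNReal.rpow_add_of_nonneg _ _ hp.le hq.le, hpq, ENNReal.rpow_one]
    rw [hIic, hIic, hIic, ENNReal.mul_rpow_of_nonneg _ _ hp.le, ENNReal.mul_rpow_of_nonneg _ _ hq.le,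
      mul_mul_mul_comm, hinv]
    gcongr)
  rw [measureReal_def, hIic, hmean, ENNReal.toReal_mul, ENNReal.toReal_inv, ← div_eq_inv_mul,
    ← measureReal_def (s := K), le_div_iff₀ hV'] at key
  simpa only [hℓ, measureReal_def, inner_sub_right, sub_nonpos] using key

theorem volume_inter_halfspace_le {n : ℕ} {K : Set (EuclideanSpace ℝ (Fin n))} (hK : IsCompact K)
    (hKc : Convex ℝ K) {w c : EuclideanSpace ℝ (Fin n)} (hw : w ≠ 0)
    (hc : c = (volume K).toReal⁻¹ • ∫ y in K, y) :
    volume.real (K ∩ {x | ⟪w, x - c⟫ ≤ 0}) ≤ (1 - 1 / Real.exp 1) * volume.real K := by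
  have hV : volume K ≠ ⊤ := hK.measure_ne_top
  rcases eq_or_ne (volume K) 0 with hK₀ | hK₀
  · have := measure_mono_null (Set.inter_subset_left (t := {x | ⟪w, x - c⟫ ≤ 0})) hK₀
    simp [measureReal_def, hK₀, this]
  have hg := grunbaum hK hKc hK₀ (-w)
  rw [← hc] at hg
  have hclosed : ∀ u : EuclideanSpace ℝ (Fin n), IsClosed {x | ⟪u, x - c⟫ ≤ 0} := fun u =>
    isClosed_le (by fun_prop) continuous_const
  have hnull : volume ((K ∩ {x | ⟪w, x - c⟫ ≤ 0}) ∩ (K ∩ {x | ⟪-w, x - c⟫ ≤ 0})) = 0 := by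
    refine measure_mono_null (t := (AffineSubspace.mk' c (ℝ ∙ w)ᗮ : Set _)) ?_
      (Measure.addHaar_affineSubspace _ _ ?_)
    · rintro x ⟨⟨-, h1⟩, -, h2⟩
      simp only [Set.mem_ofPred_eq, inner_neg_left] at h1 h2
      rw [SetLike.mem_coe, AffineSubspace.mem_mk', vsub_eq_sub,
        Submodule.mem_orthogonal_singleton_iff_inner_right]
      linarith
    · intro h
      have : w + c ∈ AffineSubspace.mk' c (ℝ ∙ w)ᗮ := h ▸ AffineSubspace.mem_top _ _ _
      rw [AffineSubspace.mem_mk', vsub_eq_sub, add_sub_cancel_right,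
        Submodule.mem_orthogonal_singleton_iff_inner_right, inner_self_eq_zero] at this
      exact hw this
  have hunion : (K ∩ {x | ⟪w, x - c⟫ ≤ 0}) ∪ (K ∩ {x | ⟪-w, x - c⟫ ≤ 0}) = K := by
    rw [← Set.inter_union_distrib_left, Set.inter_eq_left]
    intro x _
    simp only [Set.mem_union, Set.mem_ofPred_eq, inner_neg_left, Left.neg_nonpos_iff]
    exact le_total _ _
  have hadd := measureReal_union_add_inter (μ := volume) (s := K ∩ {x | ⟪w, x - c⟫ ≤ 0})
    (t := K ∩ {x | ⟪-w, x - c⟫ ≤ 0}) (hK.inter_right (hclosed _)).measurableSet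
    (hK.inter_right (hclosed _)).measure_ne_top (hK.inter_right (hclosed _)).measure_ne_top
  rw [hunion, measureReal_def (s := _ ∩ _ ∩ _), hnull] at hadd
  rw [Real.exp_neg] at hg
  simp only [ENNReal.toReal_zero] at hadd
  rw [one_div]
  linarith

section CenterOfGravity

variable {n : ℕ} {S : ℕ → Set (EuclideanSpace ℝ (Fin n))} {c w : ℕ → EuclideanSpace ℝ (Fin n)}

theorem isCompact_and_convex_of_halfspace_cuts (h₁ : IsCompact (S 1)) (h₁' : Convex ℝ (S 1))
    (hS : ∀ t ≥ 1, S (t + 1) = S t ∩ {x | ⟪w t, x - c t⟫ ≤ 0}) {t : ℕ} (ht : 1 ≤ t) :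
    IsCompact (S t) ∧ Convex ℝ (S t) := by
  induction t, ht using Nat.le_induction with
  | base => exact ⟨h₁, h₁'⟩
  | succ t ht ih =>
    rw [hS t ht]
    refine ⟨ih.1.inter_right (isClosed_le (by fun_prop) continuous_const), ih.2.inter ?_⟩
    simp only [inner_sub_right, sub_nonpos]
    exact convex_halfSpace_le (innerSL ℝ (w t)).toLinearMap.isLinear _

theorem exists_cut_of_notMem (hS : ∀ t ≥ 1, S (t + 1) = S t ∩ {x | ⟪w t, x - c t⟫ ≤ 0})
    {x : EuclideanSpace ℝ (Fin n)} (hx : x ∈ S 1) (t : ℕ) (hxt : x ∉ S (t + 1)) :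
    ∃ r ∈ Finset.Icc 1 t, 0 < ⟪w r, x - c r⟫ := by
  induction t with
  | zero => exact absurd hx hxt
  | succ t ih =>
    by_cases h : x ∈ S (t + 1)
    · refine ⟨t + 1, by simp, ?_⟩
      by_contra! hle
      exact hxt (hS (t + 1) (by simp) ▸ ⟨h, hle⟩)
    · obtain ⟨r, hr, hr'⟩ := ih h
      rw [Finset.mem_Icc] at hr
      exact ⟨r, Finset.mem_Icc.2 ⟨hr.1, hr.2.trans t.le_succ⟩, hr'⟩

theorem volume_center_of_gravity_le (h₁ : IsCompact (S 1)) (h₁' : Convex ℝ (S 1))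
    (hc : ∀ t ≥ 1, c t = ((volume (S t)).toReal)⁻¹ • ∫ x in S t, x)
    (hS : ∀ t ≥ 1, S (t + 1) = S t ∩ {x | ⟪w t, x - c t⟫ ≤ 0})
    (t : ℕ) (hw : ∀ r ∈ Finset.Icc 1 t, w r ≠ 0) :
    volume.real (S (t + 1)) ≤ (1 - 1 / Real.exp 1) ^ t * volume.real (S 1) := by
  have hρ : 0 ≤ 1 - 1 / Real.exp 1 := by
    rw [sub_nonneg, div_le_one (Real.exp_pos 1)]
    exact Real.one_le_exp zero_le_one
  induction t with
  | zero => simp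
  | succ t ih =>
    have ht : 1 ≤ t + 1 := Nat.le_add_left 1 t
    obtain ⟨hcomp, hconv⟩ := isCompact_and_convex_of_halfspace_cuts h₁ h₁' hS ht
    rw [hS (t + 1) ht, pow_succ', mul_assoc]
    refine (volume_inter_halfspace_le hcomp hconv (hw _ (by simp)) (hc _ ht)).trans ?_
    refine mul_le_mul_of_nonneg_left (ih fun r hr => hw r ?_) hρ
    rw [Finset.mem_Icc] at hr ⊢
    exact ⟨hr.1, hr.2.trans t.le_succ⟩

end CenterOfGravity

/-- Convergence rate of the center of gravity method. -/
theorem stmt_1 (n : ℕ) (X : Set (EuclideanSpace ℝ (Fin n)))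
    (hXcomp : IsCompact X) (hXconv : Convex ℝ X) (hXint : (interior X).Nonempty)
    (f : EuclideanSpace ℝ (Fin n) → ℝ)
    (hfc : ContinuousOn f X) (hfconv : ConvexOn ℝ X f)
    (B : ℝ) (hB : ∀ x ∈ X, |f x| ≤ B)
    (S : ℕ → Set (EuclideanSpace ℝ (Fin n)))
    (c w : ℕ → EuclideanSpace ℝ (Fin n))
    (hS1 : S 1 = X)
    (hc : ∀ t ≥ 1, c t = ((volume (S t)).toReal)⁻¹ • ∫ x in S t, x ∂volume)
    (hw : ∀ t ≥ 1, ∀ y ∈ X, f (c t) - f y ≤ ⟪w t, c t - y⟫)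
    (hS : ∀ t ≥ 1, S (t + 1) = S t ∩ {x | ⟪w t, x - c t⟫ ≤ 0})
    (t : ℕ) (ht : 1 ≤ t) :
    (Finset.Icc 1 t).inf' (Finset.nonempty_Icc.mpr ht) (fun r => f (c r)) -
      sInf (f '' X) ≤ 2 * B * (1 - 1 / Real.exp 1) ^ ((t : ℝ) / (n : ℝ)) := by
  obtain ⟨x₀, hx₀, hmin⟩ := hXcomp.exists_isMinOn (hXint.mono interior_subset) hfc
  have hleast : IsLeast (f '' X) (f x₀) :=
    ⟨⟨x₀, hx₀, rfl⟩, by rintro _ ⟨y, hy, rfl⟩; exact hmin hy⟩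
  rw [hleast.csInf_eq]
  have hB₀ : 0 ≤ B := (abs_nonneg _).trans (hB x₀ hx₀)
  have hgap : ∀ y ∈ X, f y - f x₀ ≤ 2 * B := fun y hy => by
    linarith [(abs_le.1 (hB y hy)).2, (abs_le.1 (hB x₀ hx₀)).1]
  set ρ : ℝ := 1 - 1 / Real.exp 1 with hρ
  have hρ₀ : 0 < ρ := by
    rw [hρ, sub_pos, div_lt_one (Real.exp_pos 1)]
    exact Real.one_lt_exp_iff.2 one_pos
  have hρ₁ : ρ < 1 := by
    rw [hρ, sub_lt_self_iff]
    positivity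
  have hinf : ∀ r ∈ Finset.Icc 1 t, ∀ a, f (c r) - f x₀ ≤ a →
      (Finset.Icc 1 t).inf' (Finset.nonempty_Icc.mpr ht) (fun r => f (c r)) - f x₀ ≤ a :=
    fun r hr a h => (sub_le_sub_right (Finset.inf'_le _ hr) _).trans h
  rcases Nat.eq_zero_or_pos n with rfl | hn
  · refine hinf 1 (by simpa using ht) _ ?_
    rw [Subsingleton.elim (c 1) x₀, sub_self]
    positivity
  by_cases hw₀ : ∃ r ∈ Finset.Icc 1 t, w r = 0
  · obtain ⟨r, hr, hwr⟩ := hw₀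
    refine hinf r hr _ ((hw r (Finset.mem_Icc.1 hr).1 x₀ hx₀).trans ?_)
    rw [hwr, inner_zero_left]
    positivity
  push Not at hw₀
  have hn' : (0 : ℝ) < n := by exact_mod_cast hn
  have ht' : (0 : ℝ) < t := by exact_mod_cast ht
  have hδ : ρ ^ ((t : ℝ) / n) < 1 := Real.rpow_lt_one hρ₀.le hρ₁ (by positivity)
  have hlim : Filter.Tendsto (fun ε : ℝ => 2 * B * ε) (nhdsWithin (ρ ^ ((t : ℝ) / n))
      (Set.Ioi (ρ ^ ((t : ℝ) / n)))) (nhds (2 * B * ρ ^ ((t : ℝ) / n))) :=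
    (Continuous.tendsto (by fun_prop) _).mono_left nhdsWithin_le_nhds
  refine ge_of_tendsto hlim ?_
  filter_upwards [Ioo_mem_nhdsGT hδ] with ε ⟨hε, hε₁⟩
  have hε₀ : 0 < ε := (Real.rpow_pos_of_pos hρ₀ _).trans hε
  have hV : volume X ≠ ⊤ := hXcomp.measure_ne_top
  have hV₀ : 0 < volume.real X := ENNReal.toReal_pos
    (isOpen_interior.measure_pos volume hXint |>.trans_le (measure_mono interior_subset)).ne' hV
  have hvol := volume_center_of_gravity_le (hS1 ▸ hXcomp) (hS1 ▸ hXconv) hc hS t hw₀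
  rw [hS1] at hvol
  have hpow : ρ ^ t < ε ^ n := by
    calc ρ ^ t = (ρ ^ ((t : ℝ) / n)) ^ n := by
          rw [← Real.rpow_natCast (_ ^ _), ← Real.rpow_mul hρ₀.le, div_mul_cancel₀ _ hn'.ne',
            Real.rpow_natCast]
      _ < ε ^ n := pow_lt_pow_left₀ hε (by positivity) hn.ne'
  have hnot : ¬ AffineMap.homothety x₀ ε '' X ⊆ S (t + 1) := by
    intro hsub
    have hcomp := (isCompact_and_convex_of_halfspace_cuts (hS1 ▸ hXcomp) (hS1 ▸ hXconv) hS
      (Nat.le_add_left 1 t)).1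
    have hle := measureReal_mono (μ := volume) hsub hcomp.measure_ne_top
    rw [measureReal_def, Measure.addHaar_image_homothety, finrank_euclideanSpace_fin,
      ENNReal.toReal_mul, ENNReal.toReal_ofReal (abs_nonneg _), abs_of_pos (by positivity),
      ← measureReal_def] at hle
    exact hpow.not_ge (le_of_mul_le_mul_right (hle.trans hvol) hV₀)
  obtain ⟨_, ⟨y, hy, rfl⟩, hz⟩ := Set.not_subset.1 hnot
  set z := AffineMap.homothety x₀ ε y with hzdef
  have hzc : z = (1 - ε) • x₀ + ε • y := by
    rw [hzdef, AffineMap.homothety_apply, vsub_eq_sub, vadd_eq_add]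
    module
  have hzX : z ∈ X := hzc ▸ hXconv hx₀ hy (by linarith) hε₀.le (by ring)
  have hfz : f z ≤ (1 - ε) * f x₀ + ε * f y :=
    hzc ▸ hfconv.2 hx₀ hy (by linarith) hε₀.le (by ring)
  obtain ⟨r, hr, hpos⟩ := exists_cut_of_notMem hS (hS1 ▸ hzX) t hz
  refine hinf r hr _ ?_
  have hsubg := hw r (Finset.mem_Icc.1 hr).1 z hzX
  rw [← neg_sub z, inner_neg_right] at hsubg
  have := mul_le_mul_of_nonneg_left (hgap y hy) hε₀.le
  linarith
end

section
/- Let n ≥ 2, let H₀ ∈ ℝ^{n×n} be symmetric positive definite, c₀ ∈ ℝⁿ, and set E₀ = {x ∈ ℝⁿ : (x - c₀)ᵀ H₀⁻¹ (x - c₀) ≤ 1}. Let w ∈ ℝⁿ with w ≠ 0, and define c = c₀ - (1/(n+1)) · H₀ w / √(wᵀ H₀ w) and H = (n²/(n² - 1)) · (H₀ - (2/(n+1)) · H₀ w wᵀ H₀ / (wᵀ H₀ w)). Then H is symmetric positive definite, the ellipsoid E = {x ∈ ℝⁿ : (x - c)ᵀ H⁻¹ (x - c) ≤ 1} contains the half-ellipsoid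 {x ∈ E₀ : wᵀ(x - c₀) ≤ 0}, and vol(E) ≤ exp(-1/(2n)) · vol(E₀). -/
open MeasureTheory Matrix
open scoped ENNReal

open scoped MatrixOrder in
/-- A real positive semidefinite matrix factors as `Bᵀ * B`. -/
lemma Matrix.PosSemidef.exists_eq_transpose_mul_self {ι : Type*} [Fintype ι] [DecidableEq ι]
    {A : Matrix ι ι ℝ} (hA : A.PosSemidef) : ∃ B : Matrix ι ι ℝ, A = Bᵀ * B := by
  obtain ⟨B, hB⟩ := CStarAlgebra.nonneg_iff_eq_star_mul_self.mp hA.nonneg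
  exact ⟨B, by rw [hB, star_eq_conjTranspose, conjTranspose_eq_transpose_of_trivial]⟩

/-- The volume of an ellipsoid in terms of the volume of the Euclidean unit ball. -/
lemma volume_ellipsoid {ι : Type*} [Fintype ι] [DecidableEq ι] {P : Matrix ι ι ℝ}
    (hP : P.PosDef) (c : ι → ℝ) :
    volume {x : ι → ℝ | (x - c) ⬝ᵥ (P⁻¹ *ᵥ (x - c)) ≤ 1} =
      ENNReal.ofReal (Real.sqrt P.det) * volume {x : ι → ℝ | x ⬝ᵥ x ≤ 1} := by
  obtain ⟨B, hB⟩ := hP.inv.posSemidef.exists_eq_transpose_mul_self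
  have hdet : P.det = (B.det⁻¹) ^ 2 := by
    have h := congrArg det hB
    rw [det_nonsing_inv, Ring.inverse_eq_inv', det_mul, det_transpose] at h
    rw [← inv_inv P.det, h, inv_pow, sq]
  have hB0 : LinearMap.det (toLin' B) ≠ 0 := by
    rw [LinearMap.det_toLin']
    intro h
    have := hP.det_pos
    simp [hdet, h] at this
  have hset : {x : ι → ℝ | (x - c) ⬝ᵥ (P⁻¹ *ᵥ (x - c)) ≤ 1} =
      (fun x => x - c) ⁻¹' (toLin' B ⁻¹' {x : ι → ℝ | x ⬝ᵥ x ≤ 1}) := by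
    ext x
    simp only [Set.mem_ofPred_eq, Set.mem_preimage, toLin'_apply, hB, ← mulVec_mulVec]
    rw [dotProduct_mulVec, vecMul_transpose]
  simp_rw [hset, sub_eq_add_neg]
  rw [measure_preimage_add_right, Measure.addHaar_preimage_linearMap _ hB0,
    LinearMap.det_toLin', hdet, Real.sqrt_sq_eq_abs]

/-- The determinant of a rank-one downdate of `A` in the direction `A *ᵥ w`. -/
lemma Matrix.det_sub_smul_vecMulVec_mulVec {ι : Type*} [Fintype ι] [DecidableEq ι]
    (A : Matrix ι ι ℝ) (w : ι → ℝ) (t : ℝ) :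
    (A - t • vecMulVec (A *ᵥ w) (w ᵥ* A)).det = A.det * (1 - t * (w ⬝ᵥ (A *ᵥ w))) := by
  have h : A - t • vecMulVec (A *ᵥ w) (w ᵥ* A) =
      A * (1 + vecMulVec (-t • w) (w ᵥ* A)) := by
    rw [mul_add, mul_one, mul_vecMulVec, mulVec_smul, smul_vecMulVec, neg_smul, sub_eq_add_neg]
  rw [h, det_mul, vecMulVec_eq Unit, det_one_add_replicateCol_mul_replicateRow,
    dotProduct_smul, ← dotProduct_mulVec, smul_eq_mul]
  ring

/-- Sherman-Morrison for a rank-one downdate of `A` in the direction `A *ᵥ w`. -/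
lemma Matrix.sub_smul_vecMulVec_mulVec_mul {ι : Type*} [Fintype ι] [DecidableEq ι]
    {A : Matrix ι ι ℝ} (hA : IsUnit A.det) (w : ι → ℝ) {s t : ℝ}
    (hst : s - t - s * t * (w ⬝ᵥ (A *ᵥ w)) = 0) :
    (A - t • vecMulVec (A *ᵥ w) (w ᵥ* A)) * (A⁻¹ + s • vecMulVec w w) = 1 := by
  have h1 : (w ᵥ* A) ᵥ* A⁻¹ = w := by rw [vecMul_vecMul, mul_nonsing_inv _ hA, vecMul_one]
  rw [sub_mul, mul_add, mul_add, mul_nonsing_inv _ hA, smul_mul_assoc, smul_mul_assoc,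
    vecMulVec_mul, h1, mul_smul_comm, mul_smul_comm, mul_vecMulVec, vecMulVec_mul_vecMulVec,
    ← dotProduct_mulVec, vecMulVec_smul]
  have : (1 : Matrix ι ι ℝ) + s • vecMulVec (A *ᵥ w) w - (t • vecMulVec (A *ᵥ w) w +
      t • s • (w ⬝ᵥ (A *ᵥ w)) • vecMulVec (A *ᵥ w) w) =
      1 + (s - t - s * t * (w ⬝ᵥ (A *ᵥ w))) • vecMulVec (A *ᵥ w) w := by
    module
  simpa [hst] using this

lemma sq_le_one_add_mul_log_add_one_sub_mul_log {x : ℝ} (hx0 : 0 < x) (hx1 : x < 1) :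
    x ^ 2 ≤ (1 + x) * Real.log (1 + x) + (1 - x) * Real.log (1 - x) := by
  have hx : |x| < 1 := abs_lt.2 ⟨by linarith, hx1⟩
  have hx2 : |x ^ 2| < 1 := abs_lt.2 ⟨by nlinarith, by nlinarith⟩
  have h1 := (Real.hasSum_log_sub_log_of_abs_lt_one hx).mul_left x
  have h2 := (Real.hasSum_pow_div_log_of_abs_lt_one hx2).add (hasSum_ite_eq 0 (x ^ 2))
  have hle := hasSum_le (fun k => ?_) h2 h1
  · have h3 : Real.log (1 - x ^ 2) = Real.log (1 + x) + Real.log (1 - x) := by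
      rw [← Real.log_mul (by linarith) (by linarith)]
      ring_nf
    rw [h3] at hle
    linarith
  · have hpow : x * (2 * (1 / (2 * (k : ℝ) + 1)) * x ^ (2 * k + 1)) =
        2 / (2 * (k : ℝ) + 1) * (x ^ 2) ^ (k + 1) := by
      rw [← pow_mul]; ring
    rw [hpow]
    rcases Nat.eq_zero_or_pos k with rfl | hk
    · norm_num
      linarith
    · rw [if_neg hk.ne', add_zero, div_eq_mul_inv, mul_comm]
      have : (1 : ℝ) ≤ k := by exact_mod_cast hk
      gcongr
      rw [inv_eq_one_div, div_le_div_iff₀ (by positivity) (by positivity)]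
      linarith

/-- The volume ratio in the central-cut ellipsoid method. -/
lemma ellipsoid_det_factor_le {n : ℕ} (hn : 2 ≤ n) :
    ((n : ℝ) ^ 2 / ((n : ℝ) ^ 2 - 1)) ^ n * (1 - 2 / ((n : ℝ) + 1)) ≤
      Real.exp (-1 / (2 * (n : ℝ))) ^ 2 := by
  have hn' : (2 : ℝ) ≤ n := by exact_mod_cast hn
  have hpos : (0 : ℝ) < n := by linarith
  have hsq : (0 : ℝ) < (n : ℝ) ^ 2 - 1 := by nlinarith
  have hx0 : (0 : ℝ) < (n : ℝ)⁻¹ := by positivity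
  have hx1 : (n : ℝ)⁻¹ < 1 := inv_lt_one_of_one_lt₀ (by linarith)
  have key := sq_le_one_add_mul_log_add_one_sub_mul_log hx0 hx1
  have hp : (0 : ℝ) < 1 + (n : ℝ)⁻¹ := by positivity
  have hm : (0 : ℝ) < 1 - (n : ℝ)⁻¹ := by linarith
  have e1 : (n : ℝ) ^ 2 / ((n : ℝ) ^ 2 - 1) = ((1 + (n : ℝ)⁻¹) * (1 - (n : ℝ)⁻¹))⁻¹ := by
    have : (1 + (n : ℝ)⁻¹) * (1 - (n : ℝ)⁻¹) = ((n : ℝ) ^ 2 - 1) / (n : ℝ) ^ 2 := by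
      field_simp
      ring
    rw [this, inv_div]
  have e2 : 1 - 2 / ((n : ℝ) + 1) = (1 - (n : ℝ)⁻¹) / (1 + (n : ℝ)⁻¹) := by
    field_simp
    ring
  rw [e1, e2, ← Real.exp_nat_mul, ← Real.log_le_iff_le_exp (by positivity),
    Real.log_mul (by positivity) (by positivity), Real.log_pow, Real.log_inv,
    Real.log_mul hp.ne' hm.ne', Real.log_div hm.ne' hp.ne']
  set L := Real.log (1 + (n : ℝ)⁻¹)
  set M := Real.log (1 - (n : ℝ)⁻¹)
  have hr : ((2 : ℕ) : ℝ) * (-1 / (2 * (n : ℝ))) = -(n : ℝ)⁻¹ := by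
    push_cast
    field_simp
  rw [hr]
  have h := mul_le_mul_of_nonneg_left key hpos.le
  have c1 : (n : ℝ) * (n : ℝ)⁻¹ ^ 2 = (n : ℝ)⁻¹ := by field_simp
  have c2 : (n : ℝ) * ((1 + (n : ℝ)⁻¹) * L + (1 - (n : ℝ)⁻¹) * M) =
      (n : ℝ) * (L + M) + L - M := by
    field_simp
    ring
  rw [c1, c2] at h
  linarith

/-- The ellipsoid-method geometric lemma: the explicitly given ellipsoid `E` contains
the half-ellipsoid `{x ∈ E₀ : wᵀ(x - c₀) ≤ 0}` and its volume is at most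
`exp(-1/(2n))` times the volume of `E₀`. -/
theorem stmt_2 (n : ℕ) (hn : 2 ≤ n)
    (H0 : Matrix (Fin n) (Fin n) ℝ) (hH0 : H0.PosDef)
    (c0 w : Fin n → ℝ) (hw : w ≠ 0)
    (E0 : Set (Fin n → ℝ))
    (hE0 : E0 = {x : Fin n → ℝ | (x - c0) ⬝ᵥ (H0⁻¹ *ᵥ (x - c0)) ≤ 1})
    (c : Fin n → ℝ)
    (hc : c = c0 - (((n : ℝ) + 1)⁻¹ * (Real.sqrt (w ⬝ᵥ (H0 *ᵥ w)))⁻¹) • (H0 *ᵥ w))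
    (H : Matrix (Fin n) (Fin n) ℝ)
    (hH : H = ((n : ℝ) ^ 2 / ((n : ℝ) ^ 2 - 1)) •
      (H0 - (2 / ((n : ℝ) + 1) * (w ⬝ᵥ (H0 *ᵥ w))⁻¹) •
        Matrix.vecMulVec (H0 *ᵥ w) (w ᵥ* H0))) :
    H.PosDef ∧
    {x ∈ E0 | w ⬝ᵥ (x - c0) ≤ 0} ⊆
      {x : Fin n → ℝ | (x - c) ⬝ᵥ (H⁻¹ *ᵥ (x - c)) ≤ 1} ∧
    volume {x : Fin n → ℝ | (x - c) ⬝ᵥ (H⁻¹ *ᵥ (x - c)) ≤ 1} ≤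
      ENNReal.ofReal (Real.exp (-1 / (2 * (n : ℝ)))) * volume E0 := by
  have hn' : (2 : ℝ) ≤ n := by exact_mod_cast hn
  have hpos : (0 : ℝ) < n := by linarith
  have hsq : (0 : ℝ) < (n : ℝ) ^ 2 - 1 := by nlinarith
  have hn1 : (0 : ℝ) < (n : ℝ) - 1 := by linarith
  set d : ℝ := w ⬝ᵥ (H0 *ᵥ w) with hd
  have hd0 : 0 < d := by simpa using hH0.dotProduct_mulVec_pos hw
  set α : ℝ := (n : ℝ) ^ 2 / ((n : ℝ) ^ 2 - 1) with hα
  have hα0 : 0 < α := by positivity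
  have hunit : IsUnit H0.det := hH0.det_pos.ne'.isUnit
  set K : Matrix (Fin n) (Fin n) ℝ :=
    α⁻¹ • (H0⁻¹ + (2 / ((n : ℝ) - 1) * d⁻¹) • vecMulVec w w) with hK
  have hmul : H * K = 1 := by
    rw [hH, hK, smul_mul_smul_comm, mul_inv_cancel₀ hα0.ne', one_smul]
    apply sub_smul_vecMulVec_mulVec_mul hunit
    rw [← hd]
    field_simp
    ring
  have hKpos : K.PosDef := by
    refine PosDef.smul (hH0.inv.add_posSemidef (PosSemidef.smul ?_ (by positivity))) (by positivity)
    simpa using posSemidef_vecMulVec_self_star w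
  have hinv : H⁻¹ = K := inv_eq_right_inv hmul
  have hHpos : H.PosDef := by
    rw [← posDef_inv_iff, hinv]
    exact hKpos
  refine ⟨hHpos, ?_, ?_⟩
  · rintro x ⟨hx, hwx⟩
    rw [hE0, Set.mem_ofPred_eq] at hx
    set s := Real.sqrt d with hs
    have hs0 : 0 < s := Real.sqrt_pos.2 hd0
    have hds : d = s ^ 2 := (Real.sq_sqrt hd0.le).symm
    set y := x - c0 with hy
    have hxc : x - c = y + (((n : ℝ) + 1)⁻¹ * s⁻¹) • (H0 *ᵥ w) := by
      rw [hc, hy]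
      abel
    have hHinv : H0⁻¹ *ᵥ (H0 *ᵥ w) = w := by
      rw [mulVec_mulVec, nonsing_inv_mul _ hunit, one_mulVec]
    have hquad (t : ℝ) : (y + t • (H0 *ᵥ w)) ⬝ᵥ (H0⁻¹ *ᵥ (y + t • (H0 *ᵥ w))) =
        y ⬝ᵥ (H0⁻¹ *ᵥ y) + 2 * t * (w ⬝ᵥ y) + t ^ 2 * d := by
      have hsymm : (H0 *ᵥ w) ⬝ᵥ (H0⁻¹ *ᵥ y) = w ⬝ᵥ y := by
        rw [dotProduct_mulVec, ← mulVec_transpose, ← conjTranspose_eq_transpose_of_trivial,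
          hH0.inv.isHermitian.eq, hHinv]
      simp only [mulVec_add, mulVec_smul, hHinv, dotProduct_add, add_dotProduct, smul_dotProduct,
        dotProduct_smul, smul_eq_mul, hsymm]
      rw [dotProduct_comm y w, dotProduct_comm (H0 *ᵥ w) w, ← hd]
      ring
    obtain ⟨a, ha⟩ : ∃ a, w ⬝ᵥ y = a * s := ⟨w ⬝ᵥ y / s, by field_simp⟩
    set q := y ⬝ᵥ (H0⁻¹ *ᵥ y) with hq
    have ha0 : a ≤ 0 := by
      by_contra! h
      nlinarith [mul_pos h hs0]
    have haq : a ^ 2 ≤ q := by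
      have h := hH0.inv.posSemidef.dotProduct_mulVec_nonneg (y + (-a * s⁻¹) • (H0 *ᵥ w))
      rw [star_trivial, hquad, ha, hds] at h
      have : q + 2 * (-a * s⁻¹) * (a * s) + (-a * s⁻¹) ^ 2 * s ^ 2 = q - a ^ 2 := by
        field_simp
        ring
      linarith
    have ha1 : -1 ≤ a := by nlinarith
    have hwv (v : Fin n → ℝ) : v ⬝ᵥ (K *ᵥ v) =
        α⁻¹ * (v ⬝ᵥ (H0⁻¹ *ᵥ v) + 2 / ((n : ℝ) - 1) * d⁻¹ * (w ⬝ᵥ v) ^ 2) := by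
      rw [hK, smul_mulVec, add_mulVec, smul_mulVec, vecMulVec_mulVec]
      simp only [dotProduct_smul, dotProduct_add, smul_eq_mul, op_smul_eq_smul]
      rw [dotProduct_comm v w]
      ring
    rw [Set.mem_ofPred_eq, hinv, hwv, hxc, hquad, dotProduct_add, dotProduct_smul, ← hd, ha, hds,
      smul_eq_mul]
    have hval : α⁻¹ * (q + 2 * (((n : ℝ) + 1)⁻¹ * s⁻¹) * (a * s) +
        (((n : ℝ) + 1)⁻¹ * s⁻¹) ^ 2 * s ^ 2 + 2 / ((n : ℝ) - 1) * (s ^ 2)⁻¹ *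
          (a * s + ((n : ℝ) + 1)⁻¹ * s⁻¹ * s ^ 2) ^ 2) =
        1 + α⁻¹ * ((q - 1) + 2 / ((n : ℝ) - 1) * (a * (1 + a))) := by
      rw [hα]
      field_simp
      ring
    rw [hval]
    have h1 : 2 / ((n : ℝ) - 1) * (a * (1 + a)) ≤ 0 :=
      mul_nonpos_of_nonneg_of_nonpos (by positivity) (by nlinarith)
    have h2 : α⁻¹ * ((q - 1) + 2 / ((n : ℝ) - 1) * (a * (1 + a))) ≤ 0 :=
      mul_nonpos_of_nonneg_of_nonpos (by positivity) (by linarith)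
    linarith
  · rw [volume_ellipsoid hHpos, hE0, volume_ellipsoid hH0, ← mul_assoc,
      ← ENNReal.ofReal_mul (Real.exp_pos _).le]
    gcongr
    have hdet : H.det = (α ^ n * (1 - 2 / ((n : ℝ) + 1))) * H0.det := by
      rw [hH, det_smul, Fintype.card_fin, det_sub_smul_vecMulVec_mulVec, ← hd,
        inv_mul_cancel_right₀ hd0.ne']
      ring
    refine Real.sqrt_le_iff.2 ⟨by positivity, ?_⟩
    rw [mul_pow, Real.sq_sqrt hH0.det_pos.le, hdet]
    exact mul_le_mul_of_nonneg_right (ellipsoid_det_factor_le hn) hH0.det_pos.le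
end

section
/- Let A ∈ ℝ^{n×n} be symmetric positive definite, b ∈ ℝⁿ, and f(x) = (1/2)⟪x, A x⟫ - ⟪b, x⟫, so that ∇f(x) = A x - b. Let p₀, …, p_{n-1} ∈ ℝⁿ be nonzero vectors that are pairwise A-orthogonal, i.e. ⟪p_i, A p_j⟫ = 0 for i ≠ j. Given any x₀ ∈ ℝⁿ, define x_{t+1} = x_t - (⟪A x_t - b, p_t⟫ / ⟪p_t, A p_t⟫) · p_t for 0 ≤ t ≤ n-1. Then x_n = A⁻¹ b, the unique minimizer of f on ℝⁿ. -/
open Matrix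

namespace Matrix

variable {ι : Type*} [Fintype ι] {A : Matrix ι ι ℝ}

theorem PosDef.dotProduct_mulVec_self_pos (hA : A.PosDef) {v : ι → ℝ} (hv : v ≠ 0) :
    0 < v ⬝ᵥ (A *ᵥ v) := by
  simpa using hA.dotProduct_mulVec_pos hv

theorem PosDef.dotProduct_mulVec_comm (hA : A.PosDef) (v w : ι → ℝ) :
    v ⬝ᵥ (A *ᵥ w) = w ⬝ᵥ (A *ᵥ v) := by
  have hAt : Aᵀ = A := by simpa using hA.isHermitian.eq
  rw [dotProduct_mulVec, ← mulVec_transpose, hAt, dotProduct_comm]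

/-- A vector orthogonal to a full family of nonzero `A`-orthogonal vectors vanishes. -/
theorem PosDef.eq_zero_of_forall_dotProduct_eq_zero [DecidableEq ι] (hA : A.PosDef)
    {p : ι → ι → ℝ} (hp0 : ∀ i, p i ≠ 0)
    (hp : ∀ i j, i ≠ j → p i ⬝ᵥ (A *ᵥ p j) = 0)
    {r : ι → ℝ} (hr : ∀ i, r ⬝ᵥ p i = 0) : r = 0 := by
  have hdiag : of p * (A * (of p)ᵀ) = diagonal fun i => p i ⬝ᵥ (A *ᵥ p i) := by
    ext i j
    change p i ⬝ᵥ (A *ᵥ p j) = _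
    rcases eq_or_ne i j with rfl | hij
    · simp
    · rw [diagonal_apply_ne _ hij, hp i j hij]
  have hdet : (of p).det ≠ 0 := by
    intro h
    have h' := congrArg det hdiag
    rw [det_mul, h, zero_mul, det_diagonal] at h'
    exact (Finset.prod_pos fun i _ => hA.dotProduct_mulVec_self_pos (hp0 i)).ne h'
  refine eq_zero_of_mulVec_eq_zero hdet ?_
  ext i
  change p i ⬝ᵥ r = 0
  rw [dotProduct_comm, hr]

/-- After `t` exact line searches along `A`-orthogonal directions, the gradient is orthogonal to
the first `t` directions. -/
theorem PosDef.gradient_dotProduct_eq_zero {n : ℕ} {A : Matrix (Fin n) (Fin n) ℝ} (hA : A.PosDef)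
    {b : Fin n → ℝ} {p : Fin n → Fin n → ℝ} (hp0 : ∀ i, p i ≠ 0)
    (hp : ∀ i j, i ≠ j → p i ⬝ᵥ (A *ᵥ p j) = 0) {x : ℕ → Fin n → ℝ}
    (hx : ∀ t : Fin n, x ((t : ℕ) + 1) =
      x t - (((A *ᵥ x t - b) ⬝ᵥ p t) / (p t ⬝ᵥ (A *ᵥ p t))) • p t)
    {t : ℕ} (ht : t ≤ n) (i : Fin n) (hi : (i : ℕ) < t) :
    (A *ᵥ x t - b) ⬝ᵥ p i = 0 := by
  induction t with
  | zero => omega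
  | succ t ih =>
    have hstep := hx ⟨t, ht⟩
    simp only at hstep
    rw [hstep, mulVec_sub, mulVec_smul, sub_right_comm, sub_dotProduct, smul_dotProduct,
      smul_eq_mul, dotProduct_comm (A *ᵥ p ⟨t, ht⟩)]
    rcases eq_or_ne i ⟨t, ht⟩ with rfl | hne
    · rw [div_mul_cancel₀ _ (hA.dotProduct_mulVec_self_pos (hp0 _)).ne', sub_self]
    · have hlt : (i : ℕ) < t := by
        have := Fin.val_ne_of_ne hne
        simp only at this
        omega
      rw [hp i _ hne, ih (by omega) hlt, mul_zero, sub_zero]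

/-- A positive definite quadratic exceeds its value at a stationary point everywhere else. -/
theorem PosDef.quadratic_lt_of_mulVec_eq (hA : A.PosDef) {b y z : ι → ℝ} (hy : A *ᵥ y = b)
    (hz : z ≠ y) :
    (1 / 2) * (y ⬝ᵥ (A *ᵥ y)) - b ⬝ᵥ y < (1 / 2) * (z ⬝ᵥ (A *ᵥ z)) - b ⬝ᵥ z := by
  have h := hA.dotProduct_mulVec_self_pos (sub_ne_zero.mpr hz)
  have hc := hA.dotProduct_mulVec_comm y z
  simp only [mulVec_sub, sub_dotProduct, dotProduct_sub] at h
  rw [hc, hy] at h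
  rw [hy, dotProduct_comm b y, dotProduct_comm b z]
  linarith

end Matrix

/-- Minimization of a positive definite quadratic along `A`-orthogonal directions
reaches the exact optimum `A⁻¹ b` after `n` steps, and `A⁻¹ b` is the unique
minimizer of `f(x) = ½ xᵀAx - bᵀx`. -/
theorem stmt_3 (n : ℕ) (A : Matrix (Fin n) (Fin n) ℝ) (hA : A.PosDef)
    (b : Fin n → ℝ)
    (f : (Fin n → ℝ) → ℝ)
    (hf : ∀ v, f v = (1 / 2) * (v ⬝ᵥ (A *ᵥ v)) - b ⬝ᵥ v)
    (p : Fin n → Fin n → ℝ)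
    (hp0 : ∀ i, p i ≠ 0)
    (hportho : ∀ i j, i ≠ j → p i ⬝ᵥ (A *ᵥ p j) = 0)
    (x : ℕ → Fin n → ℝ)
    (hiter : ∀ t : Fin n, x ((t : ℕ) + 1) =
      x t - (((A *ᵥ x t - b) ⬝ᵥ p t) / (p t ⬝ᵥ (A *ᵥ p t))) • p t) :
    x n = A⁻¹ *ᵥ b ∧ ∀ z : Fin n → ℝ, z ≠ A⁻¹ *ᵥ b → f (A⁻¹ *ᵥ b) < f z := by
  have hdet : IsUnit A.det := hA.det_pos.ne'.isUnit
  have hres : A *ᵥ x n - b = 0 := hA.eq_zero_of_forall_dotProduct_eq_zero hp0 hportho fun i =>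
    hA.gradient_dotProduct_eq_zero hp0 hportho hiter le_rfl i i.isLt
  refine ⟨?_, fun z hz => ?_⟩
  · rw [← sub_eq_zero.mp hres, mulVec_mulVec, nonsing_inv_mul A hdet, one_mulVec]
  · rw [hf, hf]
    refine hA.quadratic_lt_of_mulVec_eq ?_ hz
    rw [mulVec_mulVec, mul_nonsing_inv A hdet, one_mulVec]
end

section
/- Let X ⊆ ℝⁿ be a compact convex set contained in the closed Euclidean ball of radius R > 0 centered at a point x₁ ∈ X, and let f : X → ℝ be convex. Fix t ≥ 1 and set η = R/(L√t), where L > 0. Suppose the sequences (x_s) and (y_s) satisfy: for each s ≥ 1, g_s is a subgradient of f at x_s with ‖g_s‖₂ ≤ L, y_{s+1} = x_s - η g_s, and x_{s+1} = Π_X(y_{s+1}). Then for every x ∈ X, f((1/t) Σ_{s=1}^t x_s) - f(x) ≤ R L / √t. -/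
open scoped RealInnerProductSpace

/-- A nearest point `p` of a convex set to `u` is at least as close as `u` to every point of the
set. -/
theorem norm_sub_le_of_forall_norm_sub_le {E : Type*} [NormedAddCommGroup E]
    [InnerProductSpace ℝ E] {K : Set E} (hK : Convex ℝ K) {u p z : E} (hp : p ∈ K)
    (hmin : ∀ w ∈ K, ‖p - u‖ ≤ ‖w - u‖) (hz : z ∈ K) : ‖p - z‖ ≤ ‖u - z‖ := by
  have hinf : ‖u - p‖ = ⨅ w : K, ‖u - w‖ := by
    have : Nonempty K := ⟨⟨p, hp⟩⟩
    refine le_antisymm (le_ciInf fun w => ?_) ?_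
    · rw [norm_sub_rev u p, norm_sub_rev u w]
      exact hmin w w.2
    · exact ciInf_le (f := fun w : K => ‖u - w‖)
        ⟨0, by rintro _ ⟨w, rfl⟩; exact norm_nonneg _⟩ ⟨p, hp⟩
  have hinner := (norm_eq_iInf_iff_real_inner_le_zero hK hp).1 hinf z hz
  have hsq : ‖u - z‖ ^ 2 = ‖u - p‖ ^ 2 - 2 * inner ℝ (u - p) (z - p) + ‖p - z‖ ^ 2 := by
    rw [norm_sub_rev p z, ← norm_sub_sq_real, sub_sub_sub_cancel_right]
  refine abs_le_of_sq_le_sq' ?_ (norm_nonneg _) |>.2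
  nlinarith [sq_nonneg ‖u - p‖]

/-- The one-step progress inequality for projected subgradient descent. -/
theorem projected_subgradient_step {E : Type*} [NormedAddCommGroup E]
    [InnerProductSpace ℝ E] {K : Set E} (hK : Convex ℝ K) {a g p z : E} {η L δ : ℝ}
    (hη : 0 ≤ η) (hg : ‖g‖ ≤ L) (hp : p ∈ K)
    (hmin : ∀ w ∈ K, ‖p - (a - η • g)‖ ≤ ‖w - (a - η • g)‖) (hz : z ∈ K)
    (hδ : δ ≤ inner ℝ g (a - z)) :
    2 * η * δ ≤ ‖a - z‖ ^ 2 - ‖p - z‖ ^ 2 + η ^ 2 * L ^ 2 := by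
  have hproj := norm_sub_le_of_forall_norm_sub_le hK hp hmin hz
  have hsq : ‖a - η • g - z‖ ^ 2
      = ‖a - z‖ ^ 2 - 2 * (η * inner ℝ g (a - z)) + η ^ 2 * ‖g‖ ^ 2 := by
    rw [sub_right_comm, norm_sub_sq_real, real_inner_smul_right, real_inner_comm, norm_smul,
      mul_pow, Real.norm_eq_abs, sq_abs]
  have hp2 : ‖p - z‖ ^ 2 ≤ ‖a - η • g - z‖ ^ 2 := by gcongr
  have hg2 : η ^ 2 * ‖g‖ ^ 2 ≤ η ^ 2 * L ^ 2 := by gcongr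
  have hδ2 : η * δ ≤ η * inner ℝ g (a - z) := by gcongr
  linarith

/-- Convergence rate of projected subgradient descent for convex Lipschitz functions. -/
theorem stmt_4 (n : ℕ) (X : Set (EuclideanSpace ℝ (Fin n)))
    (hXcomp : IsCompact X) (hXconv : Convex ℝ X)
    (R L : ℝ) (hR : 0 < R) (hL : 0 < L)
    (f : EuclideanSpace ℝ (Fin n) → ℝ) (hfconv : ConvexOn ℝ X f)
    (t : ℕ) (ht : 1 ≤ t)
    (η : ℝ) (hη : η = R / (L * Real.sqrt t))
    (x y g : ℕ → EuclideanSpace ℝ (Fin n))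
    (hx1 : x 1 ∈ X)
    (hXball : X ⊆ Metric.closedBall (x 1) R)
    (hg : ∀ s ≥ 1, ∀ z ∈ X, f (x s) - f z ≤ ⟪g s, x s - z⟫)
    (hgnorm : ∀ s ≥ 1, ‖g s‖ ≤ L)
    (hy : ∀ s ≥ 1, y (s + 1) = x s - η • g s)
    (hprojmem : ∀ s ≥ 1, x (s + 1) ∈ X)
    (hproj : ∀ s ≥ 1, ∀ z ∈ X, ‖x (s + 1) - y (s + 1)‖ ≤ ‖z - y (s + 1)‖)
    (z : EuclideanSpace ℝ (Fin n)) (hz : z ∈ X) :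
    f ((t : ℝ)⁻¹ • ∑ s ∈ Finset.Icc 1 t, x s) - f z ≤ R * L / Real.sqrt t := by
  have hr : 0 < Real.sqrt t := Real.sqrt_pos.2 (by exact_mod_cast ht)
  have hr2 : Real.sqrt t ^ 2 = t := Real.sq_sqrt (Nat.cast_nonneg t)
  have ht0 : (0 : ℝ) < t := by exact_mod_cast ht
  have hηpos : 0 < η := by rw [hη]; positivity
  have hηR : η * (L * Real.sqrt t) = R := by rw [hη]; field_simp
  have hxmem : ∀ s ≥ 1, x s ∈ X := by
    intro s hs
    obtain rfl | hs' := eq_or_lt_of_le hs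
    · exact hx1
    · obtain ⟨k, rfl⟩ : ∃ k, s = k + 1 := ⟨s - 1, by omega⟩
      exact hprojmem k (by omega)
  have hstep : ∀ s ≥ 1, 2 * η * (f (x s) - f z)
      ≤ ‖x s - z‖ ^ 2 - ‖x (s + 1) - z‖ ^ 2 + η ^ 2 * L ^ 2 := fun s hs =>
    projected_subgradient_step hXconv hηpos.le (hgnorm s hs) (hprojmem s hs)
      (fun w hw => by simpa only [hy s hs] using hproj s hs w hw) hz (hg s hs z hz)
  have htel : ∀ k : ℕ, 2 * η * ∑ s ∈ Finset.Icc 1 k, (f (x s) - f z)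
      ≤ ‖x 1 - z‖ ^ 2 - ‖x (k + 1) - z‖ ^ 2 + k * (η ^ 2 * L ^ 2) := by
    intro k
    induction k with
    | zero => simp
    | succ k ih =>
      rw [Finset.sum_Icc_succ_top (by omega), mul_add]
      push_cast
      linarith [hstep (k + 1) (by omega)]
  have hdist : ‖x 1 - z‖ ^ 2 ≤ R ^ 2 := by
    have h := hXball hz
    rw [Metric.mem_closedBall, dist_comm, dist_eq_norm] at h
    gcongr
  have hsum : ∑ s ∈ Finset.Icc 1 t, (f (x s) - f z) ≤ R * L * Real.sqrt t := by
    have hR2 : (t : ℝ) * (η ^ 2 * L ^ 2) = R ^ 2 := by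
      linear_combination -(η ^ 2 * L ^ 2) * hr2 + (η * (L * Real.sqrt t) + R) * hηR
    refine le_of_mul_le_mul_left ?_ hηpos
    have hRR : η * (R * L * Real.sqrt t) = R ^ 2 := by linear_combination R * hηR
    linarith [htel t, sq_nonneg ‖x (t + 1) - z‖]
  have hjensen : f ((t : ℝ)⁻¹ • ∑ s ∈ Finset.Icc 1 t, x s)
      ≤ (t : ℝ)⁻¹ * ∑ s ∈ Finset.Icc 1 t, f (x s) := by
    have h := hfconv.map_sum_le (t := Finset.Icc 1 t) (w := fun _ => (t : ℝ)⁻¹) (p := x)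
      (fun _ _ => by positivity) (by simp [ht0.ne'])
      (fun s hs => hxmem s (Finset.mem_Icc.1 hs).1)
    simpa only [← Finset.smul_sum, smul_eq_mul, ← Finset.mul_sum] using h
  calc f ((t : ℝ)⁻¹ • ∑ s ∈ Finset.Icc 1 t, x s) - f z
      ≤ (t : ℝ)⁻¹ * ∑ s ∈ Finset.Icc 1 t, f (x s) - f z := by gcongr
    _ = (t : ℝ)⁻¹ * ∑ s ∈ Finset.Icc 1 t, (f (x s) - f z) := by
      rw [Finset.sum_sub_distrib, Finset.sum_const, Nat.card_Icc, Nat.add_sub_cancel,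
        nsmul_eq_mul, mul_sub, inv_mul_cancel_left₀ ht0.ne']
    _ ≤ (t : ℝ)⁻¹ * (R * L * Real.sqrt t) := by gcongr
    _ = R * L / Real.sqrt t := by
      nth_rewrite 1 [← hr2]
      field_simp
end

section
/- Let f : ℝⁿ → ℝ be convex, differentiable, and β-smooth (β > 0), and let x* be a global minimizer of f. Define the gradient descent iterates x_{s+1} = x_s - (1/β)∇f(x_s) starting from any x₁ ∈ ℝⁿ. Then for every t ≥ 2, f(x_t) - f(x*) ≤ 2β‖x₁ - x*‖₂² / (t - 1). -/
open scoped RealInnerProductSpace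

section GradientInequalities

variable {E : Type*} [NormedAddCommGroup E] [InnerProductSpace ℝ E] [CompleteSpace E] {f : E → ℝ}

lemma DifferentiableAt.hasDerivAt_comp_add_smul {x v : E} {r : ℝ}
    (hf : DifferentiableAt ℝ f (x + r • v)) :
    HasDerivAt (fun r : ℝ => f (x + r • v)) ⟪gradient f (x + r • v), v⟫ r := by
  have hline : HasDerivAt (fun r : ℝ => x + r • v) v r := by
    simpa using ((hasDerivAt_id r).smul_const v).const_add x
  exact hf.hasGradientAt.hasFDerivAt.comp_hasDerivAt r hline

/-- A convex function lies above its tangent hyperplanes. -/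
lemma ConvexOn.add_inner_gradient_le (hconv : ConvexOn ℝ Set.univ f) {x : E}
    (hf : DifferentiableAt ℝ f x) (y : E) :
    f x + ⟪gradient f x, y - x⟫ ≤ f y := by
  have hc : ConvexOn ℝ Set.univ (fun r : ℝ => f (x + r • (y - x))) := by
    have h := hconv.comp_affineMap (AffineMap.lineMap (k := ℝ) x y)
    simpa [Function.comp_def, AffineMap.lineMap_apply, add_comm] using h
  have hd := DifferentiableAt.hasDerivAt_comp_add_smul (x := x) (v := y - x) (r := 0)
    (by simpa using hf)
  have h := hc.le_slope_of_hasDerivAt (Set.mem_univ 0) (Set.mem_univ 1) zero_lt_one hd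
  simp only [slope_def_field, zero_smul, one_smul, add_zero, add_sub_cancel, sub_zero, div_one] at h
  linarith

/-- The quadratic upper bound for functions with Lipschitz gradient. -/
lemma le_add_inner_gradient_add_sq {β : ℝ} (hf : Differentiable ℝ f)
    (hsmooth : ∀ x y, ‖gradient f x - gradient f y‖ ≤ β * ‖x - y‖) (x v : E) :
    f (x + v) ≤ f x + ⟪gradient f x, v⟫ + β / 2 * ‖v‖ ^ 2 := by
  have hd (r : ℝ) : HasDerivAt
      (fun r : ℝ => f (x + r • v) - r * ⟪gradient f x, v⟫ - β / 2 * ‖v‖ ^ 2 * r ^ 2)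
      (⟪gradient f (x + r • v), v⟫ - ⟪gradient f x, v⟫ - β * ‖v‖ ^ 2 * r) r := by
    have h := (((hf (x + r • v)).hasDerivAt_comp_add_smul).sub
      ((hasDerivAt_id r).mul_const ⟪gradient f x, v⟫)).sub
      ((hasDerivAt_pow 2 r).const_mul (β / 2 * ‖v‖ ^ 2))
    exact h.congr_deriv (by norm_num; ring)
  have hanti := antitoneOn_of_deriv_nonpos (convex_Icc (0 : ℝ) 1)
    (fun r _ => (hd r).continuousAt.continuousWithinAt)
    (fun r _ => (hd r).differentiableAt.differentiableWithinAt) (fun r hr => by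
      rw [interior_Icc] at hr
      rw [(hd r).deriv, ← inner_sub_left]
      have hgrad := hsmooth (x + r • v) x
      rw [add_sub_cancel_left, norm_smul, Real.norm_of_nonneg hr.1.le] at hgrad
      have hinner := real_inner_le_norm (gradient f (x + r • v) - gradient f x) v
      nlinarith [mul_le_mul_of_nonneg_right hgrad (norm_nonneg v)])
  have h := hanti (Set.left_mem_Icc.2 zero_le_one) (Set.right_mem_Icc.2 zero_le_one) zero_le_one
  simp only [zero_smul, one_smul, add_zero] at h
  linarith

/-- A gradient step of size `1 / β` decreases the value by at least `‖∇f x‖² / (2β)`. -/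
lemma gradient_step_le {β : ℝ} (hβ : 0 < β) (hf : Differentiable ℝ f)
    (hsmooth : ∀ x y, ‖gradient f x - gradient f y‖ ≤ β * ‖x - y‖) (x : E) :
    f (x - (1 / β) • gradient f x) ≤ f x - ‖gradient f x‖ ^ 2 / (2 * β) := by
  have h := le_add_inner_gradient_add_sq hf hsmooth x (-((1 / β) • gradient f x))
  rw [← sub_eq_add_neg, inner_neg_right, real_inner_smul_right, real_inner_self_eq_norm_sq,
    norm_neg, norm_smul, Real.norm_of_nonneg (by positivity)] at h
  refine h.trans_eq ?_
  field_simp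
  ring

lemma ConvexOn.gradient_step_sub_le {β : ℝ} (hβ : 0 < β) (hconv : ConvexOn ℝ Set.univ f)
    (hf : Differentiable ℝ f)
    (hsmooth : ∀ x y, ‖gradient f x - gradient f y‖ ≤ β * ‖x - y‖) (x y : E) :
    f (x - (1 / β) • gradient f x) - f y ≤
      β / 2 * (‖x - y‖ ^ 2 - ‖x - (1 / β) • gradient f x - y‖ ^ 2) := by
  have hdesc := gradient_step_le hβ hf hsmooth x
  have htangent := hconv.add_inner_gradient_le (hf x) y
  rw [← neg_sub x y, inner_neg_right] at htangent
  have hexp : β / 2 * (‖x - y‖ ^ 2 - ‖x - (1 / β) • gradient f x - y‖ ^ 2) =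
      ⟪gradient f x, x - y⟫ - ‖gradient f x‖ ^ 2 / (2 * β) := by
    rw [sub_right_comm, norm_sub_sq_real (x - y), real_inner_smul_right, norm_smul,
      Real.norm_of_nonneg (by positivity), real_inner_comm]
    field_simp
    ring
  linarith

end GradientInequalities

/-- Convergence rate of gradient descent for convex β-smooth functions. -/
theorem stmt_5 (n : ℕ) (f : EuclideanSpace ℝ (Fin n) → ℝ)
    (hconv : ConvexOn ℝ Set.univ f) (hdiff : Differentiable ℝ f)
    (β : ℝ) (hβ : 0 < β)
    (hsmooth : ∀ x y : EuclideanSpace ℝ (Fin n),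
      ‖gradient f x - gradient f y‖ ≤ β * ‖x - y‖)
    (xstar : EuclideanSpace ℝ (Fin n)) (hmin : ∀ y, f xstar ≤ f y)
    (x : ℕ → EuclideanSpace ℝ (Fin n))
    (hiter : ∀ s ≥ 1, x (s + 1) = x s - (1 / β) • gradient f (x s))
    (t : ℕ) (ht : 2 ≤ t) :
    f (x t) - f xstar ≤ 2 * β * ‖x 1 - xstar‖ ^ 2 / ((t : ℝ) - 1) := by
  have hpot (k : ℕ) : (k : ℝ) * (f (x (k + 1)) - f xstar) + β / 2 * ‖x (k + 1) - xstar‖ ^ 2 ≤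
      β / 2 * ‖x 1 - xstar‖ ^ 2 := by
    induction k with
    | zero => simp
    | succ k ih =>
      have hdesc := gradient_step_le hβ hdiff hsmooth (x (k + 1))
      have hstep := hconv.gradient_step_sub_le hβ hdiff hsmooth (x (k + 1)) xstar
      rw [← hiter (k + 1) (by omega)] at hdesc hstep
      have hmono : f (x (k + 1 + 1)) ≤ f (x (k + 1)) :=
        hdesc.trans (sub_le_self _ (by positivity))
      push_cast
      nlinarith [mul_le_mul_of_nonneg_left hmono (Nat.cast_nonneg (α := ℝ) k)]
  obtain ⟨k, rfl⟩ := Nat.exists_eq_add_of_le' (one_le_two.trans ht)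
  have hk : (0 : ℝ) < k := by exact_mod_cast (by omega : 0 < k)
  rw [Nat.cast_add_one, add_sub_cancel_right, le_div_iff₀ hk]
  have hnonneg (z : EuclideanSpace ℝ (Fin n)) : 0 ≤ β * ‖z‖ ^ 2 := by positivity
  linarith [hpot k, hnonneg (x 1 - xstar), hnonneg (x (k + 1) - xstar)]
end

section
/- Let X ⊆ ℝⁿ be a compact convex set and f : ℝⁿ → ℝ be convex, differentiable, and β-smooth (β > 0), and let x* be a minimizer of f over X. Define the projected gradient descent iterates x_{t+1} = Π_X(x_t - (1/β)∇f(x_t)) starting from any x₁ ∈ X. Then for every t ≥ 1, f(x_t) - f(x*) ≤ (3β‖x₁ - x*‖₂² + f(x₁) - f(x*)) / t. -/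
open scoped RealInnerProductSpace

section ProjectedGradient

variable {E : Type*} [NormedAddCommGroup E] [InnerProductSpace ℝ E]

/-- A nearest point `p` of a convex set to `u` satisfies the obtuse-angle inequality. -/
lemma Convex.inner_sub_nonpos_of_forall_norm_sub_le {X : Set E} (hX : Convex ℝ X) {u p : E}
    (hp : p ∈ X) (hmin : ∀ z ∈ X, ‖p - u‖ ≤ ‖z - u‖) {z : E} (hz : z ∈ X) :
    inner ℝ (u - p) (z - p) ≤ 0 := by
  refine (norm_eq_iInf_iff_real_inner_le_zero hX hp).1 ?_ z hz
  have : Nonempty X := ⟨⟨p, hp⟩⟩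
  refine le_antisymm (le_ciInf fun w => ?_) (ciInf_le ⟨0, ?_⟩ (⟨p, hp⟩ : X))
  · rw [norm_sub_rev u p, norm_sub_rev u w]
    exact hmin w w.2
  · rintro _ ⟨w, rfl⟩
    exact norm_nonneg _

variable [CompleteSpace E]

/-- The derivative of a differentiable function along a line, in terms of the gradient. -/
lemma hasDerivAt_comp_line {f : E → ℝ} (hf : Differentiable ℝ f) (x v : E) (s : ℝ) :
    HasDerivAt (fun s : ℝ => f (x + s • v)) (inner ℝ (gradient f (x + s • v)) v) s := by
  have hline : HasDerivAt (fun s : ℝ => x + s • v) v s := by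
    simpa using ((hasDerivAt_id s).smul_const v).const_add x
  have h := (hf (x + s • v)).hasFDerivAt.comp_hasDerivAt s hline
  rwa [← inner_gradient_left] at h

/-- The tangent (first-order) inequality for a differentiable convex function. -/
lemma ConvexOn.inner_gradient_le_sub {f : E → ℝ} (hconv : ConvexOn ℝ Set.univ f)
    (hf : Differentiable ℝ f) (x y : E) :
    inner ℝ (gradient f x) (y - x) ≤ f y - f x := by
  have hline : ConvexOn ℝ Set.univ (fun s : ℝ => f (x + s • (y - x))) := by
    have h := hconv.comp_affineMap (AffineMap.lineMap (k := ℝ) x y)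
    rw [Set.preimage_univ] at h
    simpa [Function.comp_def, AffineMap.lineMap_apply, add_comm] using h
  have h := hline.le_slope_of_hasDerivAt (Set.mem_univ 0) (Set.mem_univ 1) one_pos
    (hasDerivAt_comp_line hf x (y - x) 0)
  simpa [slope_def_field] using h

/-- The descent lemma: the quadratic upper bound for a function with Lipschitz gradient. -/
lemma sub_le_inner_gradient_add_of_lipschitz_gradient {f : E → ℝ} (hf : Differentiable ℝ f)
    {β : ℝ} (hsmooth : ∀ x y : E, ‖gradient f x - gradient f y‖ ≤ β * ‖x - y‖) (x y : E) :
    f y - f x ≤ inner ℝ (gradient f x) (y - x) + β / 2 * ‖y - x‖ ^ 2 := by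
  set v := y - x with hv
  have hderiv (s : ℝ) : HasDerivAt
      (fun s : ℝ => f (x + s • v) - s * inner ℝ (gradient f x) v - β / 2 * ‖v‖ ^ 2 * s ^ 2)
      (inner ℝ (gradient f (x + s • v)) v - 1 * inner ℝ (gradient f x) v
        - β / 2 * ‖v‖ ^ 2 * (2 * s)) s := by
    have hsq : HasDerivAt (fun s : ℝ => s ^ 2) (2 * s) s := by
      simpa using hasDerivAt_pow 2 s
    exact ((hasDerivAt_comp_line hf x v s).sub ((hasDerivAt_id s).mul_const _)).sub
      (hsq.const_mul _)
  have hanti := antitoneOn_of_deriv_nonpos (convex_Icc (0 : ℝ) 1)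
    (fun s _ => (hderiv s).continuousAt.continuousWithinAt)
    (fun s _ => (hderiv s).differentiableAt.differentiableWithinAt) (fun s hs => by
      rw [interior_Icc] at hs
      rw [(hderiv s).deriv, one_mul, ← inner_sub_left]
      have hgrad : ‖gradient f (x + s • v) - gradient f x‖ ≤ β * (s * ‖v‖) := by
        simpa [norm_smul, abs_of_pos hs.1] using hsmooth (x + s • v) x
      have hinner := real_inner_le_norm (gradient f (x + s • v) - gradient f x) v
      nlinarith [mul_le_mul_of_nonneg_right hgrad (norm_nonneg v)])
  have h := hanti (Set.left_mem_Icc.2 zero_le_one) (Set.right_mem_Icc.2 zero_le_one) zero_le_one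
  simp only [one_smul, zero_smul, add_zero, hv, add_sub_cancel] at h
  rw [hv]
  linarith

/-- One step of projected gradient descent with step size `1 / β`. -/
lemma projected_gradient_step_le {X : Set E} (hX : Convex ℝ X) {f : E → ℝ}
    (hconv : ConvexOn ℝ Set.univ f) (hf : Differentiable ℝ f) {β : ℝ} (hβ : 0 < β)
    (hsmooth : ∀ x y : E, ‖gradient f x - gradient f y‖ ≤ β * ‖x - y‖) {x p y : E}
    (hp : p ∈ X) (hy : y ∈ X)
    (hproj : ∀ z ∈ X, ‖p - (x - (1 / β) • gradient f x)‖ ≤ ‖z - (x - (1 / β) • gradient f x)‖) :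
    f p - f y ≤ β / 2 * (‖x - y‖ ^ 2 - ‖p - y‖ ^ 2) := by
  have hdescent := sub_le_inner_gradient_add_of_lipschitz_gradient hf hsmooth x p
  have htangent := hconv.inner_gradient_le_sub hf x y
  have hangle : inner ℝ (gradient f x) (p - y) ≤ β * inner ℝ (x - p) (p - y) := by
    have h := hX.inner_sub_nonpos_of_forall_norm_sub_le hp hproj hy
    rw [sub_right_comm, inner_sub_left, real_inner_smul_left, ← neg_sub p y, inner_neg_right,
      inner_neg_right] at h
    have h' := mul_nonpos_of_nonneg_of_nonpos hβ.le h
    field_simp at h'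
    linarith
  have hsplit : inner ℝ (gradient f x) (p - y) =
      inner ℝ (gradient f x) (p - x) - inner ℝ (gradient f x) (y - x) := by
    rw [← inner_sub_right, sub_sub_sub_cancel_right]
  have hnorm : ‖x - y‖ ^ 2 = ‖p - x‖ ^ 2 + 2 * inner ℝ (x - p) (p - y) + ‖p - y‖ ^ 2 := by
    rw [← sub_add_sub_cancel x p y, norm_add_sq_real, norm_sub_rev x p]
  rw [hnorm]
  linarith

end ProjectedGradient

/-- Convergence rate of projected gradient descent for convex β-smooth functions. -/
theorem stmt_6 (n : ℕ) (X : Set (EuclideanSpace ℝ (Fin n)))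
    (hXcomp : IsCompact X) (hXconv : Convex ℝ X)
    (f : EuclideanSpace ℝ (Fin n) → ℝ)
    (hconv : ConvexOn ℝ Set.univ f) (hdiff : Differentiable ℝ f)
    (β : ℝ) (hβ : 0 < β)
    (hsmooth : ∀ x y : EuclideanSpace ℝ (Fin n),
      ‖gradient f x - gradient f y‖ ≤ β * ‖x - y‖)
    (xstar : EuclideanSpace ℝ (Fin n)) (hxstar : xstar ∈ X)
    (hmin : ∀ y ∈ X, f xstar ≤ f y)
    (x : ℕ → EuclideanSpace ℝ (Fin n))
    (hx1 : x 1 ∈ X)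
    (hprojmem : ∀ s ≥ 1, x (s + 1) ∈ X)
    (hproj : ∀ s ≥ 1, ∀ z ∈ X,
      ‖x (s + 1) - (x s - (1 / β) • gradient f (x s))‖ ≤
        ‖z - (x s - (1 / β) • gradient f (x s))‖)
    (t : ℕ) (ht : 1 ≤ t) :
    f (x t) - f xstar ≤
      (3 * β * ‖x 1 - xstar‖ ^ 2 + f (x 1) - f xstar) / (t : ℝ) := by
  have hstep (s : ℕ) (hs : 1 ≤ s) {y : EuclideanSpace ℝ (Fin n)} (hy : y ∈ X) :
      f (x (s + 1)) - f y ≤ β / 2 * (‖x s - y‖ ^ 2 - ‖x (s + 1) - y‖ ^ 2) :=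
    projected_gradient_step_le hXconv hconv hdiff hβ hsmooth (hprojmem s hs) hy (hproj s hs)
  have hmem (s : ℕ) (hs : 1 ≤ s) : x s ∈ X :=
    Nat.le_induction hx1 (fun k hk _ => hprojmem k hk) s hs
  have hmono (s : ℕ) (hs : 1 ≤ s) : f (x (s + 1)) ≤ f (x s) := by
    have h := hstep s hs (hmem s hs)
    rw [sub_self, norm_zero] at h
    nlinarith [mul_nonneg hβ.le (sq_nonneg ‖x (s + 1) - x s‖)]
  have hpotential : f (x t) ≤ f (x 1) ∧
      (t - 1 : ℝ) * (f (x t) - f xstar) + β / 2 * ‖x t - xstar‖ ^ 2 ≤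
        β / 2 * ‖x 1 - xstar‖ ^ 2 := by
    induction t, ht using Nat.le_induction with
    | base => simp
    | succ s hs ih =>
      refine ⟨(hmono s hs).trans ih.1, ?_⟩
      have hs' : (0 : ℝ) ≤ s - 1 := sub_nonneg.2 (by exact_mod_cast hs)
      have h := mul_le_mul_of_nonneg_left (hmono s hs) hs'
      push_cast
      linarith [hstep s hs hxstar, ih.2]
  obtain ⟨hle, hbound⟩ := hpotential
  rw [le_div_iff₀ (by exact_mod_cast ht)]
  linarith [mul_nonneg hβ.le (sq_nonneg ‖x t - xstar‖),
    mul_nonneg hβ.le (sq_nonneg ‖x 1 - xstar‖)]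
end

section
/- Let X ⊆ ℝⁿ be a compact convex set and f : ℝⁿ → ℝ be differentiable, α-strongly convex and β-smooth with 0 < α ≤ β, and let x* minimize f over X. Define the projected gradient descent iterates x_{t+1} = Π_X(x_t - (1/β)∇f(x_t)) starting from any x₁ ∈ X, and set κ = β/α. Then for every t ≥ 0, ‖x_{t+1} - x*‖₂² ≤ exp(-t/κ) · ‖x₁ - x*‖₂². -/
open scoped RealInnerProductSpace

section ProjectedGradient

variable {E : Type*} [NormedAddCommGroup E] [InnerProductSpace ℝ E]

/-- The variational inequality for a point of a convex set closest to `u`. -/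
theorem inner_sub_sub_nonpos_of_forall_norm_sub_le {K : Set E} (hK : Convex ℝ K) {u v : E}
    (hv : v ∈ K) (hmin : ∀ z ∈ K, ‖v - u‖ ≤ ‖z - u‖) {w : E} (hw : w ∈ K) :
    ⟪u - v, w - v⟫ ≤ 0 := by
  refine (norm_eq_iInf_iff_real_inner_le_zero hK hv).1 (le_antisymm ?_ ?_) w hw
  · have : Nonempty K := ⟨⟨v, hv⟩⟩
    refine le_ciInf fun z => ?_
    rw [norm_sub_rev u v, norm_sub_rev u z]
    exact hmin z z.2
  · exact ciInf_le (f := fun z : K => ‖u - z‖)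
      ⟨0, Set.forall_mem_range.2 fun _ => norm_nonneg _⟩ ⟨v, hv⟩

variable [CompleteSpace E]

/-- The quadratic upper bound for a function with `β`-Lipschitz gradient. -/
theorem le_add_inner_gradient_add_sq_of_lipschitz_gradient {f : E → ℝ}
    (hf : Differentiable ℝ f) {β : ℝ}
    (hsmooth : ∀ x y : E, ‖gradient f x - gradient f y‖ ≤ β * ‖x - y‖) (x y : E) :
    f y ≤ f x + ⟪gradient f x, y - x⟫ + β / 2 * ‖y - x‖ ^ 2 := by
  set v := y - x with hv
  let φ : ℝ → ℝ := fun s => f (x + s • v) - s * ⟪gradient f x, v⟫ - s ^ 2 * (β / 2 * ‖v‖ ^ 2)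
  have hφ (s : ℝ) : HasDerivAt φ
      (⟪gradient f (x + s • v), v⟫ - ⟪gradient f x, v⟫ - 2 * s * (β / 2 * ‖v‖ ^ 2)) s := by
    have hline : HasDerivAt (fun s : ℝ => x + s • v) v s := by
      simpa using ((hasDerivAt_id s).smul_const v).const_add x
    have hcomp : HasDerivAt (fun s : ℝ => f (x + s • v)) ⟪gradient f (x + s • v), v⟫ s := by
      simpa [Function.comp_def] using (hf (x + s • v)).hasGradientAt.hasFDerivAt.comp_hasDerivAt s hline
    simpa [φ] using (hcomp.fun_sub ((hasDerivAt_id s).mul_const ⟪gradient f x, v⟫)).fun_sub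
      ((hasDerivAt_pow 2 s).mul_const (β / 2 * ‖v‖ ^ 2))
  have hanti : AntitoneOn φ (Set.Icc 0 1) := by
    refine antitoneOn_of_deriv_nonpos (convex_Icc 0 1)
      (fun s _ => (hφ s).continuousAt.continuousWithinAt)
      (fun s _ => (hφ s).differentiableAt.differentiableWithinAt) fun s hs => ?_
    rw [interior_Icc] at hs
    rw [(hφ s).deriv, ← inner_sub_left]
    have hgrad : ‖gradient f (x + s • v) - gradient f x‖ ≤ β * (s * ‖v‖) := by
      simpa [norm_smul, abs_of_pos hs.1] using hsmooth (x + s • v) x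
    have hinner := (real_inner_le_norm (gradient f (x + s • v) - gradient f x) v).trans
      (mul_le_mul_of_nonneg_right hgrad (norm_nonneg v))
    linarith
  have h01 := hanti (Set.left_mem_Icc.2 zero_le_one) (Set.right_mem_Icc.2 zero_le_one) zero_le_one
  simp only [φ, hv, one_smul, zero_smul, add_zero, add_sub_cancel] at h01
  linarith

/-- One step of projected gradient descent with step size `1 / β` contracts the squared distance
to a minimizer by the factor `1 - α / β`. -/
theorem sq_norm_projected_gradient_step_sub_le {X : Set E} (hX : Convex ℝ X) {f : E → ℝ}
    (hf : Differentiable ℝ f) {α β : ℝ} (hβ : 0 < β)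
    (hsmooth : ∀ x y : E, ‖gradient f x - gradient f y‖ ≤ β * ‖x - y‖)
    (hstrong : ∀ x y : E, f x - f y ≤ ⟪gradient f x, x - y⟫ - α / 2 * ‖x - y‖ ^ 2)
    {z : E} (hz : z ∈ X) (hmin : ∀ y ∈ X, f z ≤ f y) {x y : E} (hy : y ∈ X)
    (hproj : ∀ w ∈ X,
      ‖y - (x - (1 / β) • gradient f x)‖ ≤ ‖w - (x - (1 / β) • gradient f x)‖) :
    ‖y - z‖ ^ 2 ≤ (1 - α / β) * ‖x - z‖ ^ 2 := by
  have hdescent := le_add_inner_gradient_add_sq_of_lipschitz_gradient hf hsmooth x y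
  have hvar : ⟪gradient f x, y - z⟫ ≤ β * ⟪x - y, y - z⟫ := by
    have h := inner_sub_sub_nonpos_of_forall_norm_sub_le hX hy hproj hz
    rw [sub_right_comm, inner_sub_left, real_inner_smul_left, ← neg_sub y z, inner_neg_right,
      inner_neg_right] at h
    have h' := mul_le_mul_of_nonneg_left h hβ.le
    field_simp at h'
    linarith
  have hsplit : ⟪gradient f x, y - z⟫ = ⟪gradient f x, y - x⟫ + ⟪gradient f x, x - z⟫ := by
    rw [← inner_add_right, sub_add_sub_cancel]
  have hnorm : ‖x - z‖ ^ 2 = ‖y - x‖ ^ 2 + 2 * ⟪x - y, y - z⟫ + ‖y - z‖ ^ 2 := by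
    rw [norm_sub_rev y x, ← norm_add_sq_real, sub_add_sub_cancel]
  have hgap : β * ‖y - z‖ ^ 2 ≤ (β - α) * ‖x - z‖ ^ 2 := by
    linear_combination 2 * hdescent + 2 * hstrong x z + 2 * hvar + 2 * hmin y hy
      - 2 * hsplit - β * hnorm
  rw [one_sub_div hβ.ne', div_mul_eq_mul_div, le_div_iff₀ hβ]
  linarith

end ProjectedGradient

/-- Linear convergence of projected gradient descent for smooth strongly convex
functions. -/
theorem stmt_9 (n : ℕ) (X : Set (EuclideanSpace ℝ (Fin n)))
    (hXcomp : IsCompact X) (hXconv : Convex ℝ X)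
    (f : EuclideanSpace ℝ (Fin n) → ℝ) (hdiff : Differentiable ℝ f)
    (α β : ℝ) (hα : 0 < α) (hαβ : α ≤ β)
    (hsmooth : ∀ x y : EuclideanSpace ℝ (Fin n),
      ‖gradient f x - gradient f y‖ ≤ β * ‖x - y‖)
    (hstrong : ∀ x y : EuclideanSpace ℝ (Fin n),
      f x - f y ≤ ⟪gradient f x, x - y⟫ - α / 2 * ‖x - y‖ ^ 2)
    (xstar : EuclideanSpace ℝ (Fin n)) (hxstar : xstar ∈ X)
    (hmin : ∀ y ∈ X, f xstar ≤ f y)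
    (κ : ℝ) (hκ : κ = β / α)
    (x : ℕ → EuclideanSpace ℝ (Fin n))
    (hx1 : x 1 ∈ X)
    (hprojmem : ∀ s ≥ 1, x (s + 1) ∈ X)
    (hproj : ∀ s ≥ 1, ∀ z ∈ X,
      ‖x (s + 1) - (x s - (1 / β) • gradient f (x s))‖ ≤
        ‖z - (x s - (1 / β) • gradient f (x s))‖)
    (t : ℕ) :
    ‖x (t + 1) - xstar‖ ^ 2 ≤ Real.exp (-(t : ℝ) / κ) * ‖x 1 - xstar‖ ^ 2 := by
  have hβ : 0 < β := hα.trans_le hαβ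
  have hstep : ∀ s ≥ 1, ‖x (s + 1) - xstar‖ ^ 2 ≤ Real.exp (-(α / β)) * ‖x s - xstar‖ ^ 2 :=
    fun s hs => (sq_norm_projected_gradient_step_sub_le hXconv hdiff hβ hsmooth hstrong hxstar hmin
      (hprojmem s hs) (hproj s hs)).trans
        (mul_le_mul_of_nonneg_right (Real.one_sub_le_exp_neg _) (sq_nonneg _))
  induction t with
  | zero => simp
  | succ t ih =>
    have hexp : Real.exp (-((t + 1 : ℕ) : ℝ) / κ) =
        Real.exp (-(α / β)) * Real.exp (-(t : ℝ) / κ) := by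
      rw [← Real.exp_add, hκ]
      congr 1
      push_cast
      field_simp
      ring
    rw [hexp, mul_assoc]
    exact (hstep (t + 1) (Nat.le_add_left 1 t)).trans
      (mul_le_mul_of_nonneg_left ih (Real.exp_pos _).le)
end

section
/- Let f : ℝⁿ → ℝ be differentiable, β-smooth and α-strongly convex with 0 < α ≤ β, let x* be the global minimizer of f, and set κ = β/α. Define the gradient descent iterates x_{t+1} = x_t - (2/(α + β))∇f(x_t) starting from any x₁ ∈ ℝⁿ. Then for every t ≥ 0, f(x_{t+1}) - f(x*) ≤ (β/2) · exp(-4t/(κ + 1)) · ‖x₁ - x*‖₂². -/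
open scoped RealInnerProductSpace

section GradientDescent

variable {E : Type*} [NormedAddCommGroup E] [InnerProductSpace ℝ E] [CompleteSpace E]

theorem gradient_eq_zero_of_forall_le {f : E → ℝ} {a : E} (h : ∀ y, f a ≤ f y) :
    gradient f a = 0 := by
  have hloc : IsLocalMin f a := Filter.Eventually.of_forall h
  simp [gradient, hloc.fderiv_eq_zero]

/-- The descent lemma: the quadratic upper bound for a `β`-smooth function. -/
theorem le_add_inner_add_sq_of_gradient_lipschitz {f : E → ℝ} (hdiff : Differentiable ℝ f)
    {β : ℝ} (hsmooth : ∀ x y : E, ‖gradient f x - gradient f y‖ ≤ β * ‖x - y‖) (x z : E) :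
    f z ≤ f x + ⟪gradient f x, z - x⟫ + β / 2 * ‖z - x‖ ^ 2 := by
  set v := z - x with hv
  let h : ℝ → ℝ := fun s => β / 2 * s ^ 2 * ‖v‖ ^ 2 + s * ⟪gradient f x, v⟫ - f (x + s • v)
  have hderiv (s : ℝ) : HasDerivAt h
      (β * s * ‖v‖ ^ 2 + ⟪gradient f x, v⟫ - ⟪gradient f (x + s • v), v⟫) s := by
    have hline : HasDerivAt (fun s : ℝ => x + s • v) v s := by
      simpa using ((hasDerivAt_id s).smul_const v).const_add x
    have hf := (hdiff (x + s • v)).hasGradientAt.hasFDerivAt.comp_hasDerivAt s hline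
    have hquad := (((hasDerivAt_pow 2 s).const_mul (β / 2)).mul_const (‖v‖ ^ 2)).add
      ((hasDerivAt_id s).mul_const ⟪gradient f x, v⟫)
    refine (hquad.sub hf).congr_deriv ?_
    simp only [InnerProductSpace.toDual_apply_apply]
    push_cast
    ring
  have hmono : MonotoneOn h (Set.Icc 0 1) := by
    refine monotoneOn_of_deriv_nonneg (convex_Icc 0 1)
      (fun s _ => (hderiv s).continuousAt.continuousWithinAt)
      (fun s _ => (hderiv s).differentiableAt.differentiableWithinAt) fun s hs => ?_
    rw [interior_Icc] at hs
    rw [(hderiv s).deriv]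
    have hcs := real_inner_le_norm (gradient f (x + s • v) - gradient f x) v
    have hlip := hsmooth (x + s • v) x
    rw [add_sub_cancel_left, norm_smul, Real.norm_of_nonneg hs.1.le] at hlip
    rw [inner_sub_left] at hcs
    nlinarith [mul_le_mul_of_nonneg_right hlip (norm_nonneg v)]
  have h01 := hmono (Set.left_mem_Icc.2 zero_le_one) (Set.right_mem_Icc.2 zero_le_one) zero_le_one
  simp only [h, hv, zero_smul, one_smul, add_zero, add_sub_cancel] at h01
  linarith

/-- Coercivity of the gradient of a `β`-smooth and `α`-strongly convex function. -/
theorem norm_sq_add_le_inner_gradient_sub {f : E → ℝ} (hdiff : Differentiable ℝ f)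
    {α β : ℝ} (hα : 0 < α) (hαβ : α ≤ β)
    (hsmooth : ∀ x y : E, ‖gradient f x - gradient f y‖ ≤ β * ‖x - y‖)
    (hstrong : ∀ x y : E, f x - f y ≤ ⟪gradient f x, x - y⟫ - α / 2 * ‖x - y‖ ^ 2) (x y : E) :
    ‖gradient f x - gradient f y‖ ^ 2 + α * β * ‖x - y‖ ^ 2 ≤
      (α + β) * ⟪gradient f x - gradient f y, x - y⟫ := by
  set p := gradient f x with hp
  set q := gradient f y with hq
  rcases hαβ.eq_or_lt with rfl | hlt
  · have hlip := hsmooth x y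
    have hxy := hstrong x y
    have hyx := hstrong y x
    rw [← hp] at hxy hlip
    rw [← hq] at hyx hlip
    rw [← neg_sub x y, inner_neg_right, norm_neg] at hyx
    rw [inner_sub_left]
    nlinarith [pow_le_pow_left₀ (norm_nonneg _) hlip 2]
  · set u := x - y with hu
    set d := p - q - α • u with hd
    set s := (β - α)⁻¹ with hs
    have hpos : 0 < β - α := sub_pos.2 hlt
    have h1 := le_add_inner_add_sq_of_gradient_lipschitz hdiff hsmooth x (x - s • d)
    have h2 := hstrong y (x - s • d)
    have h3 := le_add_inner_add_sq_of_gradient_lipschitz hdiff hsmooth y (y + s • d)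
    have h4 := hstrong x (y + s • d)
    rw [← hp, show x - s • d - x = -(s • d) by abel] at h1
    rw [← hq, show y - (x - s • d) = s • d - u by rw [hu]; abel] at h2
    rw [← hq, add_sub_cancel_left] at h3
    rw [← hp, show x - (y + s • d) = u - s • d by rw [hu]; abel] at h4
    rw [norm_neg] at h1
    rw [norm_sub_rev] at h4
    simp only [norm_sub_sq_real, norm_smul, inner_neg_right, inner_sub_right, real_inner_smul_right,
      real_inner_smul_left, mul_pow, Real.norm_eq_abs, sq_abs] at h1 h2 h3 h4
    have hpd : ⟪p, d⟫ - ⟪q, d⟫ - α * ⟪d, u⟫ = ‖d‖ ^ 2 := by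
      rw [← real_inner_self_eq_norm_sq, real_inner_comm u d, ← real_inner_smul_left,
        ← inner_sub_left, ← inner_sub_left]
    have hdu : ⟪d, u⟫ = ⟪p - q, u⟫ - α * ‖u‖ ^ 2 := by
      rw [hd, inner_sub_left, real_inner_smul_left, real_inner_self_eq_norm_sq]
    have hdd : ‖d‖ ^ 2 = ‖p - q‖ ^ 2 - 2 * α * ⟪p - q, u⟫ + α ^ 2 * ‖u‖ ^ 2 := by
      rw [hd, norm_sub_sq_real, real_inner_smul_right, norm_smul, mul_pow, Real.norm_eq_abs, sq_abs]
      ring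
    have hcancel : (β - α) * s = 1 := mul_inv_cancel₀ hpos.ne'
    have hsum : 2 * s * ‖d‖ ^ 2 ≤ ⟪d, u⟫ + (β - α) * s * s * ‖d‖ ^ 2 := by
      have hpq : ⟪p - q, u⟫ = ⟪p, u⟫ - ⟪q, u⟫ := inner_sub_left p q u
      linear_combination h1 + h2 + h3 + h4 - 2 * s * hpd - hdu - hpq
    rw [hcancel] at hsum
    have hcoc : ‖d‖ ^ 2 ≤ (β - α) * ⟪d, u⟫ := by
      calc ‖d‖ ^ 2 = (β - α) * (s * ‖d‖ ^ 2) := by rw [← mul_assoc, hcancel, one_mul]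
        _ ≤ _ := mul_le_mul_of_nonneg_left (by linarith) hpos.le
    rw [hdd, hdu] at hcoc
    linarith

theorem norm_gradient_step_sub_sq_le {f : E → ℝ} (hdiff : Differentiable ℝ f)
    {α β : ℝ} (hα : 0 < α) (hαβ : α ≤ β)
    (hsmooth : ∀ x y : E, ‖gradient f x - gradient f y‖ ≤ β * ‖x - y‖)
    (hstrong : ∀ x y : E, f x - f y ≤ ⟪gradient f x, x - y⟫ - α / 2 * ‖x - y‖ ^ 2)
    {a : E} (ha : gradient f a = 0) (x : E) :
    ‖x - (2 / (α + β)) • gradient f x - a‖ ^ 2 ≤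
      ((β - α) / (α + β)) ^ 2 * ‖x - a‖ ^ 2 := by
  have hpos : 0 < α + β := by linarith
  have hco := norm_sq_add_le_inner_gradient_sub hdiff hα hαβ hsmooth hstrong x a
  rw [ha, sub_zero] at hco
  rw [sub_right_comm, norm_sub_sq_real, real_inner_smul_right, norm_smul, mul_pow,
    Real.norm_eq_abs, sq_abs, real_inner_comm, div_pow, div_pow, ← sub_nonneg]
  have key : 0 ≤ 4 / (α + β) ^ 2 * ((α + β) * ⟪gradient f x, x - a⟫ -
      (‖gradient f x‖ ^ 2 + α * β * ‖x - a‖ ^ 2)) :=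
    mul_nonneg (by positivity) (sub_nonneg.2 hco)
  convert key using 1
  field_simp
  ring

end GradientDescent

/-- Linear convergence of gradient descent with step size `2/(α+β)` for smooth
strongly convex functions. -/
theorem stmt_11 (n : ℕ) (f : EuclideanSpace ℝ (Fin n) → ℝ)
    (hdiff : Differentiable ℝ f)
    (α β : ℝ) (hα : 0 < α) (hαβ : α ≤ β)
    (hsmooth : ∀ x y : EuclideanSpace ℝ (Fin n),
      ‖gradient f x - gradient f y‖ ≤ β * ‖x - y‖)
    (hstrong : ∀ x y : EuclideanSpace ℝ (Fin n),
      f x - f y ≤ ⟪gradient f x, x - y⟫ - α / 2 * ‖x - y‖ ^ 2)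
    (xstar : EuclideanSpace ℝ (Fin n)) (hmin : ∀ y, f xstar ≤ f y)
    (κ : ℝ) (hκ : κ = β / α)
    (x : ℕ → EuclideanSpace ℝ (Fin n))
    (hiter : ∀ s ≥ 1, x (s + 1) = x s - (2 / (α + β)) • gradient f (x s))
    (t : ℕ) :
    f (x (t + 1)) - f xstar ≤
      β / 2 * Real.exp (-(4 * (t : ℝ)) / (κ + 1)) * ‖x 1 - xstar‖ ^ 2 := by
  have hpos : 0 < α + β := by linarith
  have hgrad := gradient_eq_zero_of_forall_le hmin
  have hrate : ((β - α) / (α + β)) ^ 2 ≤ Real.exp (-4 / (κ + 1)) := by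
    have heq : (β - α) / (α + β) = -2 / (κ + 1) + 1 := by
      have hκ1 : κ + 1 = (α + β) / α := by
        rw [hκ]
        field_simp
        ring
      rw [hκ1]
      field_simp
      ring
    calc ((β - α) / (α + β)) ^ 2 ≤ Real.exp (-2 / (κ + 1)) ^ 2 := by
          refine pow_le_pow_left₀ (div_nonneg (sub_nonneg.2 hαβ) hpos.le) ?_ 2
          rw [heq]
          exact Real.add_one_le_exp _
      _ = Real.exp (-4 / (κ + 1)) := by
          rw [← Real.exp_nat_mul]
          congr 1
          push_cast
          ring
  have hdist : ‖x (t + 1) - xstar‖ ^ 2 ≤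
      Real.exp (-4 / (κ + 1)) ^ t * ‖x 1 - xstar‖ ^ 2 := by
    induction t with
    | zero => simp
    | succ k ih =>
      rw [hiter (k + 1) (by lia)]
      calc _ ≤ ((β - α) / (α + β)) ^ 2 * ‖x (k + 1) - xstar‖ ^ 2 :=
            norm_gradient_step_sub_sq_le hdiff hα hαβ hsmooth hstrong hgrad _
        _ ≤ Real.exp (-4 / (κ + 1)) * (Real.exp (-4 / (κ + 1)) ^ k * ‖x 1 - xstar‖ ^ 2) := by
            gcongr
        _ = _ := by ring
  have hexp : Real.exp (-(4 * (t : ℝ)) / (κ + 1)) = Real.exp (-4 / (κ + 1)) ^ t := by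
    rw [← Real.exp_nat_mul]
    congr 1
    ring
  have hdesc := le_add_inner_add_sq_of_gradient_lipschitz hdiff hsmooth xstar (x (t + 1))
  rw [hgrad, inner_zero_left] at hdesc
  rw [hexp]
  nlinarith [mul_le_mul_of_nonneg_left hdist (show 0 ≤ β / 2 by linarith)]
end

section
/- Let 1 ≤ t ≤ n and L, R > 0. (i) There exist a convex function f : ℝⁿ → ℝ that is L-Lipschitz on the Euclidean ball B₂(R) = {x : ‖x‖₂ ≤ R} and a map g : ℝⁿ → ℝⁿ with g(x) a subgradient of f at x for every x, such that every finite sequence x₁, …, x_t with x₁ = 0 and x_{s+1} ∈ span{g(x₁), …, g(x_s)} for 1 ≤ s ≤ t-1 satisfies min_{1 ≤ s ≤ t} f(x_s) - inf_{x ∈ B₂(R)} f(x) ≥ RL/(2(1 + √t)). (ii) For any α > 0 there exist an α-strongly convex function f : ℝⁿ → ℝ that is L-Lipschitz on B₂(L/(2α)) and a subgradient selection g as above, such that every such sequence satisfies min_{1 ≤ s ≤ t} f(x_s) - inf_{x ∈ B₂(L/(2α))} f(x) ≥ L²/(8αt). -/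
open scoped RealInnerProductSpace

section StrongSubgradient

variable {E : Type*} [NormedAddCommGroup E] [InnerProductSpace ℝ E]

/-- A function with a selection of `a`-strong subgradients satisfies the `a`-strong convexity
inequality on every segment. -/
theorem strong_convexity_of_strong_subgradient {f : E → ℝ} {g : E → E} {a : ℝ}
    (h : ∀ x y, f x - f y ≤ ⟪g x, x - y⟫ - a / 2 * ‖x - y‖ ^ 2)
    (x y : E) {p q : ℝ} (hp : 0 ≤ p) (hq : 0 ≤ q) (hpq : p + q = 1) :
    f (p • x + q • y) ≤ p * f x + q * f y - a / 2 * (p * q) * ‖x - y‖ ^ 2 := by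
  obtain rfl : p = 1 - q := by linarith
  set z := (1 - q) • x + q • y with hz
  have hzx : z - x = (-q) • (x - y) := by rw [hz]; module
  have hzy : z - y = (1 - q) • (x - y) := by rw [hz]; module
  have hx := h z x
  have hy := h z y
  rw [hzx, inner_smul_right, norm_smul, mul_pow, Real.norm_eq_abs, sq_abs] at hx
  rw [hzy, inner_smul_right, norm_smul, mul_pow, Real.norm_eq_abs, sq_abs] at hy
  nlinarith [mul_le_mul_of_nonneg_left hx hp, mul_le_mul_of_nonneg_left hy hq]

theorem convexOn_of_strong_subgradient {f : E → ℝ} {g : E → E} {a : ℝ} (ha : 0 ≤ a)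
    (h : ∀ x y, f x - f y ≤ ⟪g x, x - y⟫ - a / 2 * ‖x - y‖ ^ 2) :
    ConvexOn ℝ Set.univ f := by
  refine ⟨convex_univ, fun x _ y _ p q hp hq hpq => ?_⟩
  have := strong_convexity_of_strong_subgradient h x y hp hq hpq
  have : 0 ≤ a / 2 * (p * q) * ‖x - y‖ ^ 2 := by positivity
  simp only [smul_eq_mul]
  linarith

/-- If some selection of subgradients is `a`-strong, then every subgradient is `a`-strong. -/
theorem subgradient_strong_of_strong_subgradient {f : E → ℝ} {g : E → E} {a : ℝ}
    (h : ∀ x y, f x - f y ≤ ⟪g x, x - y⟫ - a / 2 * ‖x - y‖ ^ 2)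
    {x v : E} (hv : ∀ z, f x - f z ≤ ⟪v, x - z⟫) (y : E) :
    f x - f y ≤ ⟪v, x - y⟫ - a / 2 * ‖x - y‖ ^ 2 := by
  have key : ∀ q ∈ Set.Ioo (0 : ℝ) 1,
      f x - f y ≤ ⟪v, x - y⟫ - a / 2 * (1 - q) * ‖x - y‖ ^ 2 := by
    rintro q ⟨hq0, hq1⟩
    have h₁ := strong_convexity_of_strong_subgradient h x y (sub_nonneg.2 hq1.le) hq0.le
      (sub_add_cancel 1 q)
    have h₂ := hv ((1 - q) • x + q • y)
    rw [show x - ((1 - q) • x + q • y) = q • (x - y) by module, inner_smul_right] at h₂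
    refine le_of_mul_le_mul_left ?_ hq0
    linarith
  have hlim : Filter.Tendsto (fun q : ℝ => ⟪v, x - y⟫ - a / 2 * (1 - q) * ‖x - y‖ ^ 2)
      (nhdsWithin 0 (Set.Ioi 0)) (nhds (⟪v, x - y⟫ - a / 2 * (1 - 0) * ‖x - y‖ ^ 2)) :=
    (Continuous.tendsto (by fun_prop) 0).mono_left nhdsWithin_le_nhds
  rw [sub_zero, mul_one] at hlim
  refine ge_of_tendsto hlim ?_
  filter_upwards [Ioo_mem_nhdsGT (zero_lt_one' ℝ)] with q hq using key q hq

end StrongSubgradient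

/-- Every vector has a first index at which its largest entry among the first `t` is attained. -/
theorem exists_first_argmax {n t : ℕ} (ht1 : 1 ≤ t) (htn : t ≤ n) (x : Fin n → ℝ) :
    ∃ k : Fin n, k.val < t ∧ (∀ j : Fin n, j.val < t → x j ≤ x k) ∧
      ∀ j : Fin n, j.val < t → x j = x k → k ≤ j := by
  classical
  let S : Finset (Fin n) := Finset.univ.filter fun j => j.val < t
  have hS : S.Nonempty := ⟨⟨0, by omega⟩, by simp [S]; omega⟩
  obtain ⟨m, hmS, hm⟩ := S.exists_max_image x hS
  let T := S.filter fun j => x j = x m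
  have hT : T.Nonempty := ⟨m, by simp [T, hmS]⟩
  obtain ⟨k, hkT, hk⟩ := T.exists_min_image id hT
  simp only [T, S, Finset.mem_filter, Finset.mem_univ, true_and, id] at hkT hk hm
  refine ⟨k, hkT.1, fun j hj => hkT.2 ▸ hm j hj, fun j hj hjk => hk j ⟨hj, hjk.trans hkT.2⟩⟩

/-- Iterates in the span of the previous oracle answers `γ e_{k(x)} + a x`, where `k(x)` is the
first maximal coordinate, discover at most one new coordinate per step. -/
theorem iterate_apply_eq_zero {n t : ℕ}
    {k : EuclideanSpace ℝ (Fin n) → Fin n}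
    (hk : ∀ x : EuclideanSpace ℝ (Fin n), ∀ j : Fin n, j.val < t → x j = x (k x) → k x ≤ j)
    (a γ : ℝ) {x : ℕ → EuclideanSpace ℝ (Fin n)} (hx1 : x 1 = 0)
    (hx : ∀ s, 1 ≤ s → s + 1 ≤ t → x (s + 1) ∈ Submodule.span ℝ
      ((fun r => γ • EuclideanSpace.single (k (x r)) (1 : ℝ) + a • x r) '' Set.Icc 1 s)) :
    ∀ s, 1 ≤ s → s ≤ t → ∀ j : Fin n, s ≤ j.val + 1 → x s j = 0 := by
  intro s
  induction s using Nat.strong_induction_on with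
  | _ s ih =>
    intro hs1 hst j hj
    obtain rfl | ⟨s, rfl, hs⟩ : s = 1 ∨ ∃ s', s = s' + 1 ∧ 1 ≤ s' := by
      rcases Nat.lt_or_ge 1 s with h | h
      · exact Or.inr ⟨s - 1, by omega, by omega⟩
      · exact Or.inl (by omega)
    · simp [hx1]
    · have hle : Submodule.span ℝ ((fun r => γ • EuclideanSpace.single (k (x r)) (1 : ℝ) +
          a • x r) '' Set.Icc 1 s) ≤
          LinearMap.ker (EuclideanSpace.proj j : EuclideanSpace ℝ (Fin n) →L[ℝ] ℝ).toLinearMap := by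
        rw [Submodule.span_le]
        rintro _ ⟨r, ⟨hr1, hrs⟩, rfl⟩
        have hr := ih r (by omega) hr1 (by omega)
        have hkr : (k (x r)).val < r := by
          by_contra! hcon
          have := hk (x r) ⟨r - 1, by omega⟩ (by simp; omega)
            ((hr _ (by simp; omega)).trans (hr _ (by omega)).symm)
          rw [Fin.le_def] at this
          simp only at this
          omega
        have hne : j ≠ k (x r) := by
          rintro rfl
          omega
        simp [hr j (by omega), hne]
      simpa using hle (hx s hs hst)

/-- Nesterov's hard instance `x ↦ γ max_{i < t} x i + (a / 2) ‖x‖²`. -/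
theorem exists_hard_instance {n t : ℕ} (ht1 : 1 ≤ t) (htn : t ≤ n) {a γ ρ : ℝ}
    (ha : 0 < a) (hγ : 0 < γ) (hρ : γ / (a * √t) ≤ ρ) :
    ∃ (f : EuclideanSpace ℝ (Fin n) → ℝ)
        (g : EuclideanSpace ℝ (Fin n) → EuclideanSpace ℝ (Fin n)),
      (∀ x y, f x - f y ≤ ⟪g x, x - y⟫ - a / 2 * ‖x - y‖ ^ 2) ∧
      (∀ x ∈ Metric.closedBall (0 : EuclideanSpace ℝ (Fin n)) ρ,
        ∀ y ∈ Metric.closedBall (0 : EuclideanSpace ℝ (Fin n)) ρ,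
          |f x - f y| ≤ (γ + a * ρ) * ‖x - y‖) ∧
      (∀ x : ℕ → EuclideanSpace ℝ (Fin n), x 1 = 0 →
        (∀ s, 1 ≤ s → s + 1 ≤ t →
          x (s + 1) ∈ Submodule.span ℝ ((fun r => g (x r)) '' Set.Icc 1 s)) →
        γ ^ 2 / (2 * a * t) ≤
          (Finset.Icc 1 t).inf' (Finset.nonempty_Icc.mpr ht1) (fun s => f (x s)) -
            sInf (f '' Metric.closedBall (0 : EuclideanSpace ℝ (Fin n)) ρ)) := by
  have ht0 : (0 : ℝ) < t := by exact_mod_cast ht1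
  choose k hkt hkmax hkfirst using fun x : EuclideanSpace ℝ (Fin n) =>
    exists_first_argmax ht1 htn (fun i => x i)
  set f : EuclideanSpace ℝ (Fin n) → ℝ := fun x => γ * x (k x) + a / 2 * ‖x‖ ^ 2 with hf
  set g : EuclideanSpace ℝ (Fin n) → EuclideanSpace ℝ (Fin n) :=
    fun x => γ • EuclideanSpace.single (k x) (1 : ℝ) + a • x with hg
  have hstrong : ∀ x y, f x - f y ≤ ⟪g x, x - y⟫ - a / 2 * ‖x - y‖ ^ 2 := by
    intro x y
    have hy := mul_le_mul_of_nonneg_left (hkmax y (k x) (hkt x)) hγ.le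
    have hin : ⟪g x, x - y⟫ = γ * (x (k x) - y (k x)) + a * (‖x‖ ^ 2 - ⟪x, y⟫) := by
      simp [hg, inner_add_left, inner_smul_left, inner_sub_right, EuclideanSpace.inner_single_left]
      ring
    rw [hin, norm_sub_sq_real]
    simp only [hf]
    linarith
  have hlip : ∀ x ∈ Metric.closedBall (0 : EuclideanSpace ℝ (Fin n)) ρ, ∀ y,
      f x - f y ≤ (γ + a * ρ) * ‖x - y‖ := by
    intro x hx y
    rw [mem_closedBall_zero_iff] at hx
    have hgx : ‖g x‖ ≤ γ + a * ρ := by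
      refine (norm_add_le _ _).trans ?_
      rw [norm_smul, norm_smul, PiLp.norm_single, norm_one, mul_one,
        Real.norm_of_nonneg hγ.le, Real.norm_of_nonneg ha.le]
      gcongr
    have h₁ := hstrong x y
    have h₂ := real_inner_le_norm (g x) (x - y)
    have h₃ := mul_le_mul_of_nonneg_right hgx (norm_nonneg (x - y))
    have h₄ : 0 ≤ a / 2 * ‖x - y‖ ^ 2 := by positivity
    linarith
  have hρ0 : 0 ≤ ρ := le_trans (by positivity) hρ
  refine ⟨f, g, hstrong, fun x hx y hy => abs_sub_le_iff.2 ⟨hlip x hx y, ?_⟩, ?_⟩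
  · rw [norm_sub_rev]
    exact hlip y hy x
  intro x hx1 hx
  have hzero := iterate_apply_eq_zero hkfirst a γ hx1 hx
  have hnonneg : 0 ≤ (Finset.Icc 1 t).inf' (Finset.nonempty_Icc.mpr ht1) (fun s => f (x s)) := by
    refine Finset.le_inf' _ _ fun s hs => ?_
    rw [Finset.mem_Icc] at hs
    have h₁ := hkmax (x s) ⟨t - 1, by omega⟩ (by simp; omega)
    rw [hzero s hs.1 hs.2 _ (by simp; omega)] at h₁
    simp only [hf]
    positivity
  have hbdd : BddBelow (f '' Metric.closedBall (0 : EuclideanSpace ℝ (Fin n)) ρ) := by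
    refine ⟨f 0 - (γ + a * ρ) * ρ, ?_⟩
    rintro _ ⟨z, hz, rfl⟩
    have h₁ := hlip 0 (Metric.mem_closedBall_self hρ0) z
    rw [mem_closedBall_zero_iff] at hz
    rw [zero_sub, norm_neg] at h₁
    have h₂ : (γ + a * ρ) * ‖z‖ ≤ (γ + a * ρ) * ρ := by gcongr
    linarith
  -- the minimiser of `f`
  let y : EuclideanSpace ℝ (Fin n) :=
    WithLp.toLp 2 fun i => if i.val < t then -(γ / (a * t)) else 0
  have hynorm : ‖y‖ ^ 2 = γ ^ 2 / (a ^ 2 * t) := by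
    have hcard : (Finset.univ.filter fun i : Fin n => i.val < t).card = t := by
      rw [Fin.card_filter_val_lt, min_eq_right htn]
    rw [EuclideanSpace.real_norm_sq_eq]
    simp only [y, ite_pow, ne_eq, OfNat.ofNat_ne_zero, not_false_eq_true, zero_pow]
    rw [← Finset.sum_filter, Finset.sum_const, hcard, nsmul_eq_mul]
    field_simp
  have hymem : y ∈ Metric.closedBall (0 : EuclideanSpace ℝ (Fin n)) ρ := by
    rw [mem_closedBall_zero_iff]
    refine le_trans (le_of_eq ?_) hρ
    rw [← sq_eq_sq₀ (norm_nonneg _) (by positivity), hynorm, div_pow, mul_pow,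
      Real.sq_sqrt ht0.le]
  have hfy : f y = -(γ ^ 2 / (2 * a * t)) := by
    have : y (k y) = -(γ / (a * t)) := by simp only [y]; exact if_pos (hkt y)
    simp only [hf]
    rw [hynorm, this]
    field_simp
    ring
  have := csInf_le hbdd ⟨y, hymem, rfl⟩
  linarith

/-- Oracle complexity lower bounds for non-smooth convex optimization:
(i) the Lipschitz convex case; (ii) the strongly convex Lipschitz case. -/
theorem stmt_12 (n t : ℕ) (ht1 : 1 ≤ t) (htn : t ≤ n)
    (L R : ℝ) (hL : 0 < L) (hR : 0 < R) (α : ℝ) (hα : 0 < α) :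
    (∃ (f : EuclideanSpace ℝ (Fin n) → ℝ)
        (g : EuclideanSpace ℝ (Fin n) → EuclideanSpace ℝ (Fin n)),
      ConvexOn ℝ Set.univ f ∧
      (∀ x ∈ Metric.closedBall (0 : EuclideanSpace ℝ (Fin n)) R,
        ∀ y ∈ Metric.closedBall (0 : EuclideanSpace ℝ (Fin n)) R,
          |f x - f y| ≤ L * ‖x - y‖) ∧
      (∀ x y : EuclideanSpace ℝ (Fin n), f x - f y ≤ ⟪g x, x - y⟫) ∧
      (∀ x : ℕ → EuclideanSpace ℝ (Fin n), x 1 = 0 →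
        (∀ s, 1 ≤ s → s + 1 ≤ t →
          x (s + 1) ∈ Submodule.span ℝ ((fun r => g (x r)) '' Set.Icc 1 s)) →
        R * L / (2 * (1 + Real.sqrt t)) ≤
          (Finset.Icc 1 t).inf' (Finset.nonempty_Icc.mpr ht1) (fun s => f (x s)) -
            sInf (f '' Metric.closedBall (0 : EuclideanSpace ℝ (Fin n)) R)))
    ∧
    (∃ (f : EuclideanSpace ℝ (Fin n) → ℝ)
        (g : EuclideanSpace ℝ (Fin n) → EuclideanSpace ℝ (Fin n)),
      (∀ x y gx : EuclideanSpace ℝ (Fin n),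
        (∀ z, f x - f z ≤ ⟪gx, x - z⟫) →
          f x - f y ≤ ⟪gx, x - y⟫ - α / 2 * ‖x - y‖ ^ 2) ∧
      (∀ x ∈ Metric.closedBall (0 : EuclideanSpace ℝ (Fin n)) (L / (2 * α)),
        ∀ y ∈ Metric.closedBall (0 : EuclideanSpace ℝ (Fin n)) (L / (2 * α)),
          |f x - f y| ≤ L * ‖x - y‖) ∧
      (∀ x y : EuclideanSpace ℝ (Fin n), f x - f y ≤ ⟪g x, x - y⟫) ∧
      (∀ x : ℕ → EuclideanSpace ℝ (Fin n), x 1 = 0 →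
        (∀ s, 1 ≤ s → s + 1 ≤ t →
          x (s + 1) ∈ Submodule.span ℝ ((fun r => g (x r)) '' Set.Icc 1 s)) →
        L ^ 2 / (8 * α * t) ≤
          (Finset.Icc 1 t).inf' (Finset.nonempty_Icc.mpr ht1) (fun s => f (x s)) -
            sInf (f '' Metric.closedBall (0 : EuclideanSpace ℝ (Fin n)) (L / (2 * α))))) := by
  have ht0 : (0 : ℝ) < t := by exact_mod_cast ht1
  have hst : 0 < √(t : ℝ) := Real.sqrt_pos.2 ht0
  constructor
  · obtain ⟨f, g, hstrong, hlip, hgap⟩ := exists_hard_instance ht1 htn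
      (a := L / (R * (1 + √t))) (γ := L * √t / (1 + √t)) (ρ := R)
      (by positivity) (by positivity) (le_of_eq (by field_simp))
    have ha : 0 ≤ L / (R * (1 + √t)) := by positivity
    refine ⟨f, g, convexOn_of_strong_subgradient ha hstrong, fun x hx y hy => ?_, fun x y => ?_,
      fun x hx1 hx => ?_⟩
    · convert hlip x hx y hy using 2
      field_simp
      ring
    · have : 0 ≤ L / (R * (1 + √t)) / 2 * ‖x - y‖ ^ 2 := by positivity
      linarith [hstrong x y]
    · refine le_trans (le_of_eq ?_) (hgap x hx1 hx)
      rw [div_pow, mul_pow, Real.sq_sqrt ht0.le]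
      field_simp
  · have hρ : L / 2 / (α * √t) ≤ L / (2 * α) := by
      rw [div_div, ← mul_assoc]
      exact div_le_div_of_nonneg_left hL.le (by positivity) (le_mul_of_one_le_right (by positivity)
        (Real.one_le_sqrt.2 (by exact_mod_cast ht1)))
    obtain ⟨f, g, hstrong, hlip, hgap⟩ := exists_hard_instance ht1 htn hα (half_pos hL) hρ
    refine ⟨f, g, fun x y v hv => subgradient_strong_of_strong_subgradient hstrong hv y,
      fun x hx y hy => ?_, fun x y => ?_, fun x hx1 hx => ?_⟩
    · convert hlip x hx y hy using 2
      field_simp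
      ring
    · have : 0 ≤ α / 2 * ‖x - y‖ ^ 2 := by positivity
      linarith [hstrong x y]
    · refine le_trans (le_of_eq ?_) (hgap x hx1 hx)
      field_simp
      ring
end

section
/- Let n ≥ 1, β > 0, and let t be a positive integer with t ≤ (n-1)/2. There exists a convex, differentiable, β-smooth function f : ℝⁿ → ℝ admitting a global minimizer x*, such that every sequence x₁, …, x_t with x₁ = 0 and x_{s+1} ∈ span{∇f(x₁), …, ∇f(x_s)} for 1 ≤ s ≤ t-1 satisfies min_{1 ≤ s ≤ t} f(x_s) - f(x*) ≥ (3β/32) · ‖x₁ - x*‖₂² / (t + 1)². -/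
open scoped RealInnerProductSpace

lemma convexOn_quadratic {E F : Type*} [NormedAddCommGroup E] [InnerProductSpace ℝ E]
    [NormedAddCommGroup F] [InnerProductSpace ℝ F] (L : E →L[ℝ] F) {a : ℝ} (ha : 0 ≤ a) (b : E) :
    ConvexOn ℝ Set.univ (fun x => a / 2 * ‖L x‖ ^ 2 - ⟪b, x⟫) := by
  have h1 : ConvexOn ℝ Set.univ (fun x => ‖L x‖ ^ 2) := by
    have h := (convexOn_univ_norm (E := F)).pow (fun _ _ => norm_nonneg _) 2
    exact h.comp_linearMap (L : E →ₗ[ℝ] F)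
  have h2 : ConcaveOn ℝ Set.univ (fun x => ⟪b, x⟫) :=
    ((innerSL ℝ b : E →L[ℝ] ℝ) : E →ₗ[ℝ] ℝ).concaveOn convex_univ
  exact (h1.smul (by positivity : 0 ≤ a / 2)).sub h2

section QuadraticFunctions

variable {E F : Type*} [NormedAddCommGroup E] [InnerProductSpace ℝ E] [CompleteSpace E]
  [NormedAddCommGroup F] [InnerProductSpace ℝ F] [CompleteSpace F]

/-- The gradient of `a / 2 * ‖L x‖ ^ 2 - ⟪b, x⟫` is `a • L† (L x) - b`. -/
lemma hasGradientAt_quadratic (L : E →L[ℝ] F) (a : ℝ) (b x : E) :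
    HasGradientAt (fun x => a / 2 * ‖L x‖ ^ 2 - ⟪b, x⟫)
      (a • ContinuousLinearMap.adjoint L (L x) - b) x := by
  rw [hasGradientAt_iff_hasFDerivAt]
  have h1 : HasFDerivAt (fun x => ‖L x‖ ^ 2) _ x := (L.hasFDerivAt (x := x)).norm_sq
  have h2 : HasFDerivAt (fun x => ⟪b, x⟫) (innerSL ℝ b) x := (innerSL ℝ b).hasFDerivAt
  refine ((h1.const_mul (a / 2)).sub h2).congr_fderiv ?_
  ext v
  simp [ContinuousLinearMap.adjoint_inner_left]
  ring

lemma norm_gradient_quadratic_sub_le (L : E →L[ℝ] F) {a M : ℝ} (ha : 0 ≤ a) (hM : 0 ≤ M)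
    (hL : ∀ x, ‖L x‖ ^ 2 ≤ M ^ 2 * ‖x‖ ^ 2) (b x y : E) :
    ‖gradient (fun x => a / 2 * ‖L x‖ ^ 2 - ⟪b, x⟫) x -
      gradient (fun x => a / 2 * ‖L x‖ ^ 2 - ⟪b, x⟫) y‖ ≤ a * M ^ 2 * ‖x - y‖ := by
  rw [(hasGradientAt_quadratic L a b x).gradient, (hasGradientAt_quadratic L a b y).gradient,
    sub_sub_sub_cancel_right, ← smul_sub, ← map_sub, ← map_sub, norm_smul, Real.norm_of_nonneg ha]
  have hLM : ‖L‖ ≤ M := L.opNorm_le_bound hM fun z => by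
    refine le_of_sq_le_sq ?_ (by positivity)
    rw [mul_pow]
    exact hL z
  have h1 : ‖ContinuousLinearMap.adjoint L (L (x - y))‖ ≤ M * (M * ‖x - y‖) := by
    refine (ContinuousLinearMap.le_opNorm _ _).trans ?_
    rw [LinearIsometryEquiv.norm_map]
    have := L.le_opNorm (x - y)
    gcongr
    exact this.trans (by gcongr)
  calc a * _ ≤ a * (M * (M * ‖x - y‖)) := by gcongr
    _ = _ := by ring

end QuadraticFunctions

/-- The `i`-th coordinate of a vector if `i < k`, and `0` otherwise. -/
noncomputable def truncCoord {n k : ℕ} (hk : k ≤ n) (i : ℕ) : EuclideanSpace ℝ (Fin n) →ₗ[ℝ] ℝ :=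
  if h : i < k then (EuclideanSpace.proj (𝕜 := ℝ) (⟨i, h.trans_le hk⟩ : Fin n)).toLinearMap else 0

/-- Differences of consecutive truncated coordinates, preceded by the first coordinate. -/
noncomputable def coordDiff {n k : ℕ} (hk : k ≤ n) :
    ℕ → EuclideanSpace ℝ (Fin n) →ₗ[ℝ] ℝ
  | 0 => truncCoord hk 0
  | i + 1 => truncCoord hk i - truncCoord hk (i + 1)

/-- The linear map whose Gram matrix is tridiagonal with entries `2` and `-1`. -/
noncomputable def diffMap {n k : ℕ} (hk : k ≤ n) :
    EuclideanSpace ℝ (Fin n) →L[ℝ] EuclideanSpace ℝ (Fin (k + 1)) :=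
  LinearMap.toContinuousLinearMap
    ((WithLp.linearEquiv 2 ℝ (Fin (k + 1) → ℝ)).symm.toLinearMap ∘ₗ
      LinearMap.pi fun i : Fin (k + 1) => coordDiff hk i)

section Coordinates

variable {n k : ℕ} (hk : k ≤ n)

lemma truncCoord_of_lt {i : ℕ} (h : i < k) (x : EuclideanSpace ℝ (Fin n)) :
    truncCoord hk i x = x ⟨i, h.trans_le hk⟩ := by
  simp [truncCoord, h]

lemma truncCoord_of_le {i : ℕ} (h : k ≤ i) (x : EuclideanSpace ℝ (Fin n)) :
    truncCoord hk i x = 0 := by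
  simp [truncCoord, h.not_gt]

lemma diffMap_apply (x : EuclideanSpace ℝ (Fin n)) (i : Fin (k + 1)) :
    diffMap hk x i = coordDiff hk i x := rfl

lemma norm_sq_diffMap (x : EuclideanSpace ℝ (Fin n)) :
    ‖diffMap hk x‖ ^ 2 = truncCoord hk 0 x ^ 2 +
      ∑ i ∈ Finset.range k, (truncCoord hk i x - truncCoord hk (i + 1) x) ^ 2 := by
  rw [EuclideanSpace.real_norm_sq_eq]
  simp only [diffMap_apply]
  rw [← Finset.sum_range (fun i => coordDiff hk i x ^ 2), Finset.sum_range_succ', add_comm]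
  simp [coordDiff]

lemma sum_sq_truncCoord_le (x : EuclideanSpace ℝ (Fin n)) :
    ∑ i ∈ Finset.range k, truncCoord hk i x ^ 2 ≤ ‖x‖ ^ 2 := by
  have h : ‖x‖ ^ 2 = ∑ i ∈ Finset.range n, truncCoord le_rfl i x ^ 2 := by
    rw [EuclideanSpace.real_norm_sq_eq, Finset.sum_range]
    exact Finset.sum_congr rfl fun i _ => by rw [truncCoord_of_lt le_rfl i.2]
  rw [h]
  calc _ = ∑ i ∈ Finset.range k, truncCoord (le_refl n) i x ^ 2 :=
        Finset.sum_congr rfl fun i hi => by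
          have hi := Finset.mem_range.mp hi
          rw [truncCoord_of_lt hk hi, truncCoord_of_lt le_rfl (hi.trans_le hk)]
    _ ≤ _ := Finset.sum_le_sum_of_subset_of_nonneg (Finset.range_mono hk)
        fun _ _ _ => sq_nonneg _

lemma norm_sq_diffMap_le (x : EuclideanSpace ℝ (Fin n)) :
    ‖diffMap hk x‖ ^ 2 ≤ 2 ^ 2 * ‖x‖ ^ 2 := by
  have h := sum_sq_truncCoord_le hk x
  rw [norm_sq_diffMap]
  set u : ℕ → ℝ := fun i => truncCoord hk i x with hu
  have h1 : ∑ i ∈ Finset.range k, (u i - u (i + 1)) ^ 2 ≤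
      2 * ∑ i ∈ Finset.range k, u i ^ 2 + 2 * ∑ i ∈ Finset.range k, u (i + 1) ^ 2 := by
    rw [Finset.mul_sum, Finset.mul_sum, ← Finset.sum_add_distrib]
    exact Finset.sum_le_sum fun i _ => by nlinarith [sq_nonneg (u i + u (i + 1))]
  have h2 : ∑ i ∈ Finset.range k, u (i + 1) ^ 2 + u 0 ^ 2 = ∑ i ∈ Finset.range k, u i ^ 2 := by
    rw [← Finset.sum_range_succ' (fun i => u i ^ 2), Finset.sum_range_succ]
    simp [hu, truncCoord_of_le hk le_rfl]
  change u 0 ^ 2 + ∑ i ∈ Finset.range k, (u i - u (i + 1)) ^ 2 ≤ _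
  change ∑ i ∈ Finset.range k, u i ^ 2 ≤ _ at h
  nlinarith [sq_nonneg (u 0)]

lemma truncCoord_single {j : ℕ} (hj : j < k) (i : ℕ) :
    truncCoord hk i (EuclideanSpace.single ⟨j, hj.trans_le hk⟩ (1 : ℝ)) =
      if i = j then 1 else 0 := by
  by_cases hi : i < k
  · simp [truncCoord_of_lt hk hi]
  · rw [truncCoord_of_le hk (not_lt.mp hi), if_neg (by omega)]

/-- Applying the tridiagonal matrix enlarges the support of a vector by at most one coordinate. -/
lemma truncCoord_adjoint_diffMap_eq_zero {x : EuclideanSpace ℝ (Fin n)} {s : ℕ}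
    (hx : ∀ i, s ≤ i → truncCoord hk i x = 0) {j : ℕ} (hj : s + 1 ≤ j) :
    truncCoord hk j (ContinuousLinearMap.adjoint (diffMap hk) (diffMap hk x)) = 0 := by
  rcases lt_or_ge j k with hjk | hjk
  swap
  · exact truncCoord_of_le hk hjk _
  set e := EuclideanSpace.single (⟨j, hjk.trans_le hk⟩ : Fin n) (1 : ℝ) with he
  have hin : ∀ v : EuclideanSpace ℝ (Fin n), truncCoord hk j v = ⟪e, v⟫ := fun v => by
    rw [truncCoord_of_lt hk hjk, he, EuclideanSpace.inner_single_left]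
    simp
  rw [hin, ContinuousLinearMap.adjoint_inner_right, PiLp.inner_apply]
  refine Finset.sum_eq_zero fun i _ => ?_
  rw [diffMap_apply, diffMap_apply]
  obtain ⟨i, hi⟩ := i
  rcases i with _ | i
  · have : truncCoord hk 0 e = 0 := by rw [truncCoord_single hk hjk, if_neg (by omega)]
    simp [coordDiff, this]
  · by_cases hs : s ≤ i
    · simp [coordDiff, hx i hs, hx (i + 1) (by omega)]
    · have h1 : truncCoord hk i e = 0 := by rw [truncCoord_single hk hjk, if_neg (by omega)]
      have h2 : truncCoord hk (i + 1) e = 0 := by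
        rw [truncCoord_single hk hjk, if_neg (by omega)]
      simp [coordDiff, h1, h2]

/-- The minimum of the tridiagonal quadratic over vectors supported on the first `m`
coordinates is at least `-m / (m + 1)`. -/
lemma neg_div_le_norm_sq_diffMap_sub {m : ℕ} (hm : 0 < m) (hmk : m ≤ k)
    {x : EuclideanSpace ℝ (Fin n)} (hx : truncCoord hk m x = 0) :
    -((m : ℝ) / (m + 1)) ≤ ‖diffMap hk x‖ ^ 2 - 2 * truncCoord hk 0 x := by
  rw [norm_sq_diffMap]
  set u : ℕ → ℝ := fun i => truncCoord hk i x
  change -((m : ℝ) / (m + 1)) ≤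
    u 0 ^ 2 + ∑ i ∈ Finset.range k, (u i - u (i + 1)) ^ 2 - 2 * u 0
  have hmR : (0 : ℝ) < m := by exact_mod_cast hm
  have h1 : ∑ i ∈ Finset.range m, (u i - u (i + 1)) ^ 2 ≤
      ∑ i ∈ Finset.range k, (u i - u (i + 1)) ^ 2 :=
    Finset.sum_le_sum_of_subset_of_nonneg (Finset.range_mono hmk) fun _ _ _ => sq_nonneg _
  have h2 : u 0 ^ 2 ≤ m * ∑ i ∈ Finset.range m, (u i - u (i + 1)) ^ 2 := by
    have h := sq_sum_le_card_mul_sum_sq (s := Finset.range m) (f := fun i => u i - u (i + 1))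
    rw [Finset.sum_range_sub', Finset.card_range] at h
    rwa [show u m = 0 from hx, sub_zero] at h
  have h3 : u 0 ^ 2 / m ≤ ∑ i ∈ Finset.range k, (u i - u (i + 1)) ^ 2 := by
    rw [div_le_iff₀ hmR]
    nlinarith
  have h4 : u 0 ^ 2 + u 0 ^ 2 / m - 2 * u 0 + m / (m + 1) =
      ((m + 1) * u 0 - m) ^ 2 / (m * (m + 1)) := by
    field_simp
    ring
  have h5 : 0 ≤ ((m + 1) * u 0 - m) ^ 2 / ((m : ℝ) * (m + 1)) := by positivity
  linarith

end Coordinates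

/-- The minimizer of the tridiagonal quadratic. -/
noncomputable def linearDecay (n k : ℕ) : EuclideanSpace ℝ (Fin n) :=
  WithLp.toLp 2 fun i => if (i : ℕ) < k then 1 - ((i : ℝ) + 1) / (k + 1) else 0

lemma truncCoord_linearDecay {n k : ℕ} (hk : k ≤ n) {i : ℕ} (hi : i ≤ k) :
    truncCoord hk i (linearDecay n k) = 1 - ((i : ℝ) + 1) / (k + 1) := by
  rcases hi.lt_or_eq with h | rfl
  · simp [truncCoord_of_lt hk h, linearDecay, h]
  · rw [truncCoord_of_le hk le_rfl, div_self (by positivity), sub_self]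

lemma norm_sq_diffMap_linearDecay_sub {n k : ℕ} (hk : k ≤ n) :
    ‖diffMap hk (linearDecay n k)‖ ^ 2 - 2 * truncCoord hk 0 (linearDecay n k) =
      -((k : ℝ) / (k + 1)) := by
  rw [norm_sq_diffMap, truncCoord_linearDecay hk (Nat.zero_le k)]
  have h : ∀ i ∈ Finset.range k, (truncCoord hk i (linearDecay n k) -
      truncCoord hk (i + 1) (linearDecay n k)) ^ 2 = (1 / ((k : ℝ) + 1)) ^ 2 := fun i hi => by
    have hi := Finset.mem_range.mp hi
    rw [truncCoord_linearDecay hk hi.le, truncCoord_linearDecay hk hi]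
    push_cast
    ring
  rw [Finset.sum_congr rfl h]
  simp only [Finset.sum_const, Finset.card_range, nsmul_eq_mul, Nat.cast_zero]
  field_simp
  ring

lemma norm_sq_linearDecay_le {n k : ℕ} (hk : k ≤ n) :
    ‖linearDecay n k‖ ^ 2 ≤ ((k : ℝ) + 1) / 3 := by
  have h1 : ‖linearDecay n k‖ ^ 2 =
      ∑ i ∈ Finset.range k, (1 - ((i : ℝ) + 1) / (k + 1)) ^ 2 := by
    rw [EuclideanSpace.real_norm_sq_eq]
    simp only [linearDecay]
    rw [← Finset.sum_range
      (fun i => (if i < k then 1 - ((i : ℝ) + 1) / (k + 1) else 0) ^ 2)]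
    rw [← Finset.sum_subset (Finset.range_mono hk)]
    · exact Finset.sum_congr rfl fun i hi => by rw [if_pos (Finset.mem_range.mp hi)]
    · intro i _ hi
      rw [if_neg (by simpa using hi)]
      norm_num
  have h2 : ∀ (c : ℝ) (m : ℕ), ∑ i ∈ Finset.range m, (c - ((i : ℝ) + 1)) ^ 2 =
      m * c ^ 2 - c * (m * (m + 1)) + m * (m + 1) * (2 * m + 1) / 6 := fun c m => by
    induction m with
    | zero => simp
    | succ m ih =>
      rw [Finset.sum_range_succ, ih]
      push_cast
      ring
  have hk1 : (0 : ℝ) < k + 1 := by positivity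
  have h3 : ∑ i ∈ Finset.range k, (1 - ((i : ℝ) + 1) / (k + 1)) ^ 2 =
      (∑ i ∈ Finset.range k, ((k + 1 : ℝ) - ((i : ℝ) + 1)) ^ 2) / (k + 1 : ℝ) ^ 2 := by
    rw [Finset.sum_div]
    refine Finset.sum_congr rfl fun i _ => ?_
    field_simp
  rw [h1, h3, h2, div_le_iff₀ (by positivity)]
  have hk0 : (0 : ℝ) ≤ k := by positivity
  nlinarith [mul_nonneg hk0 hk0]

/-- Oracle complexity lower bound for smooth convex optimization. -/
theorem stmt_13 (n : ℕ) (hn : 1 ≤ n) (β : ℝ) (hβ : 0 < β)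
    (t : ℕ) (ht1 : 1 ≤ t) (htn : (t : ℝ) ≤ ((n : ℝ) - 1) / 2) :
    ∃ (f : EuclideanSpace ℝ (Fin n) → ℝ) (xstar : EuclideanSpace ℝ (Fin n)),
      ConvexOn ℝ Set.univ f ∧ Differentiable ℝ f ∧
      (∀ x y : EuclideanSpace ℝ (Fin n),
        ‖gradient f x - gradient f y‖ ≤ β * ‖x - y‖) ∧
      (∀ y, f xstar ≤ f y) ∧
      ∀ x : ℕ → EuclideanSpace ℝ (Fin n), x 1 = 0 →
        (∀ s, 1 ≤ s → s + 1 ≤ t →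
          x (s + 1) ∈ Submodule.span ℝ ((fun r => gradient f (x r)) '' Set.Icc 1 s)) →
        3 * β / 32 * (‖x 1 - xstar‖ ^ 2 / ((t : ℝ) + 1) ^ 2) ≤
          (Finset.Icc 1 t).inf' (Finset.nonempty_Icc.mpr ht1) (fun s => f (x s)) -
            f xstar := by
  have hk : 2 * t + 1 ≤ n := by
    have : (2 * t + 1 : ℝ) ≤ n := by linarith
    exact_mod_cast this
  have hk0 : 0 < 2 * t + 1 := by omega
  set b : EuclideanSpace ℝ (Fin n) :=
    EuclideanSpace.single ⟨0, hk0.trans_le hk⟩ (β / 4) with hb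
  have hbc : ∀ j, 1 ≤ j → truncCoord hk j b = 0 := fun j hj => by
    have : b = (β / 4) • EuclideanSpace.single ⟨0, hk0.trans_le hk⟩ (1 : ℝ) := by
      ext i
      simp [hb]
    rw [this, map_smul, truncCoord_single hk hk0, if_neg (by omega), smul_zero]
  set f : EuclideanSpace ℝ (Fin n) → ℝ :=
    fun x => β / 4 / 2 * ‖diffMap hk x‖ ^ 2 - ⟪b, x⟫ with hf
  have hfx : ∀ x, f x = β / 8 * (‖diffMap hk x‖ ^ 2 - 2 * truncCoord hk 0 x) := fun x => by
    rw [truncCoord_of_lt hk hk0, hf]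
    simp only [hb, EuclideanSpace.inner_single_left]
    simp
    ring
  have hlow : ∀ m, 0 < m → m ≤ 2 * t + 1 → ∀ x, truncCoord hk m x = 0 →
      β / 8 * -((m : ℝ) / (m + 1)) ≤ f x := fun m hm hmk x hx => by
    rw [hfx]
    have := neg_div_le_norm_sq_diffMap_sub hk hm hmk hx
    gcongr
  have hfstar : f (linearDecay n (2 * t + 1)) =
      β / 8 * -(((2 * t + 1 : ℕ) : ℝ) / ((2 * t + 1 : ℕ) + 1)) := by
    rw [hfx, norm_sq_diffMap_linearDecay_sub]
  refine ⟨f, linearDecay n (2 * t + 1), convexOn_quadratic _ (by positivity) _,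
    fun x => (hasGradientAt_quadratic (diffMap hk) (β / 4) b x).differentiableAt,
    fun x y => ?_, fun y => ?_, fun x hx1 hx => ?_⟩
  · have := norm_gradient_quadratic_sub_le (diffMap hk) (by positivity : 0 ≤ β / 4)
      zero_le_two (norm_sq_diffMap_le hk) b x y
    rwa [show β / 4 * 2 ^ 2 = β by ring] at this
  · rw [hfstar]
    exact hlow _ hk0 le_rfl y (truncCoord_of_le hk le_rfl y)
  · have hsupp : ∀ s, 1 ≤ s → s ≤ t → ∀ i, s ≤ i → truncCoord hk i (x s) = 0 := by
      intro s
      induction s using Nat.strong_induction_on with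
      | _ s ih =>
        intro hs1 hst i hi
        obtain rfl | ⟨s, rfl⟩ : s = 1 ∨ ∃ r, s = r + 1 + 1 := by
          rcases s with _ | _ | r
          · omega
          · exact Or.inl rfl
          · exact Or.inr ⟨r, rfl⟩
        · rw [hx1, map_zero]
        · have hle : Submodule.span ℝ ((fun r => gradient f (x r)) '' Set.Icc 1 (s + 1)) ≤
              LinearMap.ker (truncCoord hk i) := by
            rw [Submodule.span_le]
            rintro _ ⟨r, ⟨hr1, hrs⟩, rfl⟩
            change truncCoord hk i (gradient f (x r)) = 0
            rw [(hasGradientAt_quadratic (diffMap hk) (β / 4) b (x r)).gradient, map_sub,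
              map_smul, hbc i (by omega), truncCoord_adjoint_diffMap_eq_zero hk
              (ih r (by omega) hr1 (by omega)) (by omega), smul_zero, sub_zero]
          exact hle (hx (s + 1) (by omega) hst)
    have hmin : β / 8 * -((t : ℝ) / (t + 1)) ≤
        (Finset.Icc 1 t).inf' (Finset.nonempty_Icc.mpr ht1) (fun s => f (x s)) := by
      refine Finset.le_inf' _ _ fun s hs => ?_
      obtain ⟨hs1, hst⟩ := Finset.mem_Icc.mp hs
      exact hlow t ht1 (by omega) (x s) (hsupp s hs1 hst t hst)
    have hnorm := norm_sq_linearDecay_le hk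
    rw [hx1, zero_sub, norm_neg, hfstar]
    push_cast at hnorm ⊢
    have hgap : 3 * β / 32 * (((2 * t + 1 : ℝ) + 1) / 3 / ((t : ℝ) + 1) ^ 2) =
        β / 8 * -((t : ℝ) / (t + 1)) - β / 8 * -((2 * t + 1 : ℝ) / (2 * t + 1 + 1)) := by
      field_simp
      ring
    calc _ ≤ 3 * β / 32 * (((2 * t + 1 : ℝ) + 1) / 3 / ((t : ℝ) + 1) ^ 2) := by gcongr
      _ ≤ _ := by rw [hgap]; gcongr
end
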